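/- arXiv:1003.4117 — 2 statements merged into one kernel-verified Lean document; each statement's English description precedes it below -/
import Mathlib

section
/- Let s ∈ [0,T] and let μ be a finite nonnegative measure on [s,T] × H such that L₀u is μ-integrable for every u ∈ E_A([0,T]×H). If for some λ ∈ ℝ the set {λu − L₀u : u ∈ E_A([0,T]×H)} is dense in L¹([s,T]×H, μ), then the set {L₀u : u ∈ E_A([0,T]×H)} is dense in L¹([s,T]×H, μ). -/
open MeasureTheory Set Filter Topology
open scoped InnerProductSpace ENNReal NNReal

attribute [local instance] Classical.propDecidable

noncomputable section

variable (H : Type) [NormedAddCommGroup H] [InnerProductSpace ℝ H] [CompleteSpace H]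
  [SecondCountableTopology H] [MeasurableSpace H] [BorelSpace H]

/-- All data of the framework: the `C₀`-semigroup `e^{tA}` with its generator `A`
(a densely defined unbounded operator), the diffusion operator `C` (symmetric, nonnegative)
with a square root `C^{1/2}`, a Hilbert basis of `H`, the time horizon `T > 0`, and the
Borel measurable drift `F` defined on a Borel set `DF ⊆ [0,T] × H`. -/
structure FPData where
  T : ℝ
  hT : 0 < T
  S : ℝ → H →L[ℝ] H
  S_zero : S 0 = 1
  S_add : ∀ s t : ℝ, 0 ≤ s → 0 ≤ t → S (s + t) = (S s).comp (S t)
  S_cont : ∀ x : H, ContinuousOn (fun t => S t x) (Ici (0 : ℝ))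
  A : H →ₗ.[ℝ] H
  A_dense : Dense (A.domain : Set H)
  A_mem_iff : ∀ x : H, x ∈ A.domain ↔
    ∃ y : H, Tendsto (fun t : ℝ => t⁻¹ • (S t x - x)) (𝓝[>] 0) (𝓝 y)
  A_gen : ∀ x : A.domain,
    Tendsto (fun t : ℝ => t⁻¹ • (S t (x : H) - (x : H))) (𝓝[>] 0) (𝓝 (A x))
  C : H →L[ℝ] H
  C_pos : C.IsPositive
  sqrtC : H →L[ℝ] H
  sqrtC_pos : sqrtC.IsPositive
  sqrtC_sq : sqrtC.comp sqrtC = C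
  ι : Type
  basis : HilbertBasis ι ℝ H
  F : ℝ × H → H
  DF : Set (ℝ × H)
  DF_meas : MeasurableSet DF
  F_meas : Measurable F

variable {H}

/-- The spatial gradient `D_x u(t,x)` of a function `u : ℝ × H → ℝ`. -/
def xGrad (u : ℝ × H → ℝ) (p : ℝ × H) : H :=
  gradient (fun z => u (p.1, z)) p.2

/-- The set `Sf` of functions is dense in `L¹([s,T] × H, μ)`. -/
def DenseRangeL1 (μ : Measure (ℝ × H)) (Sf : Set (ℝ × H → ℝ)) : Prop :=
  ∀ f : ℝ × H → ℝ, Integrable f μ → ∀ ε > 0,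
    ∃ g ∈ Sf, Integrable g μ ∧ ∫ p, |f p - g p| ∂μ < ε

namespace FPData

variable (D : FPData H)

/-- `h ∈ C¹([0,T]; D(A*))`, represented by the pair `(h, g)` with `g t = A* (h t)`. -/
def CinDAstar (h g : ℝ → H) : Prop :=
  ContDiffOn ℝ 1 h (Icc 0 D.T) ∧ ContDiffOn ℝ 1 g (Icc 0 D.T) ∧
    ∀ t ∈ Icc 0 D.T, (h t, g t) ∈ D.A.adjoint.graph

/-- Generators of `E_A([0,T] × H)`: real parts of `φ(t) e^{i⟨x, h(t)⟩}`. -/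
def EAgen : Set (ℝ × H → ℝ) :=
  {u | ∃ (φ : ℝ → ℝ) (h g : ℝ → H), ContDiffOn ℝ 1 φ (Icc 0 D.T) ∧ φ D.T = 0 ∧
    D.CinDAstar h g ∧
    (u = (fun p => φ p.1 * Real.cos ⟪p.2, h p.1⟫_ℝ) ∨
     u = (fun p => φ p.1 * Real.sin ⟪p.2, h p.1⟫_ℝ))}

/-- The space of test functions `E_A([0,T] × H) = D(L₀)`: the linear span of the generators. -/
def EA : Set (ℝ × H → ℝ) := ↑(Submodule.span ℝ D.EAgen)

/-- The trace term `Tr[C D²_x u(t,x)] = Σ_i ⟨D²_x u(t,x)(C^{1/2} e_i), C^{1/2} e_i⟩`. -/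
def traceCD2 (u : ℝ × H → ℝ) (p : ℝ × H) : ℝ :=
  ∑' i : D.ι,
    ⟪(fderiv ℝ (gradient fun z => u (p.1, z)) p.2) (D.sqrtC (D.basis i)),
      D.sqrtC (D.basis i)⟫_ℝ

/-- The Ornstein–Uhlenbeck part `V₀u = D_t u + (1/2)Tr[C D²_x u] + ⟨x, A* D_x u⟩`
of the Kolmogorov operator. -/
def Vzero (u : ℝ × H → ℝ) (p : ℝ × H) : ℝ :=
  deriv (fun r => u (r, p.2)) p.1 + (1 / 2) * D.traceCD2 u p +
    (if hk : xGrad u p ∈ D.A.adjoint.domain then ⟪p.2, D.A.adjoint ⟨xGrad u p, hk⟩⟫_ℝ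
     else 0)

/-- The Kolmogorov operator `L₀u = V₀u + ⟨F(t,x), D_x u⟩`. -/
def Lzero (u : ℝ × H → ℝ) (p : ℝ × H) : ℝ :=
  D.Vzero u p + ⟪D.F p, xGrad u p⟫_ℝ

/-- `|F(t,x)|`, with the convention `|F(t,x)| = +∞` outside `D(F)`. -/
def FnormE (p : ℝ × H) : ℝ≥0∞ := if p ∈ D.DF then (‖D.F p‖₊ : ℝ≥0∞) else ⊤

/-- Condition (1.6): `∫ (|⟨y, A*h(t)⟩| + |F(t,y)|) dμ < ∞` for all `h ∈ C¹([0,T]; D(A*))`. -/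
def DriftIntegrable (μ : Measure (ℝ × H)) : Prop :=
  ∀ h g : ℝ → H, D.CinDAstar h g →
    ∫⁻ p, ((‖⟪p.2, g p.1⟫_ℝ‖₊ : ℝ≥0∞) + D.FnormE p) ∂μ < ⊤

/-- `μ(dt,dx) = μ_t(dx) dt` on `[s,T] × H` for a measurable kernel `(μ_t)`. -/
def IsKernel (s : ℝ) (μ : Measure (ℝ × H)) (μt : ℝ → Measure H) : Prop :=
  (∀ B : Set H, MeasurableSet B → Measurable fun t => μt t B) ∧
  ∀ E : Set (ℝ × H), MeasurableSet E → μ E = ∫⁻ t in Icc s D.T, μt t {x | (t, x) ∈ E}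

/-- `μ = μ_t dt` is a solution of the Fokker–Planck equation (1.5) with initial condition
`ζ` at time `s` (membership in `M_{s,ζ}`). -/
def IsFPSol (s : ℝ) (ζ : Measure H) (μ : Measure (ℝ × H)) (μt : ℝ → Measure H) : Prop :=
  (∀ t ∈ Icc s D.T, IsProbabilityMeasure (μt t)) ∧
  D.IsKernel s μ μt ∧ D.DriftIntegrable μ ∧
  ∀ u ∈ D.EA, ∀ᵐ t ∂(volume.restrict (Icc s D.T)),
    ∫ y, u (t, y) ∂(μt t) =
      ∫ y, u (s, y) ∂ζ + ∫ r in Icc s t, (∫ y, D.Lzero u (r, y) ∂(μt r))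

/-- The set `M_{s,ζ}` of solutions of the Fokker–Planck equation. -/
def Mset (s : ℝ) (ζ : Measure H) : Set (Measure (ℝ × H)) :=
  {μ | ∃ μt : ℝ → Measure H, D.IsFPSol s ζ μ μt}

/-- Membership in `M_s^λ` (formula (4.2)): `ν = ν_t dt` is a finite nonnegative measure with
`∫ L₀ u dν ≤ 2λ ∫ u dν` for all nonnegative `u ∈ E_A`. -/
def IsSubInv (lam s : ℝ) (ν : Measure (ℝ × H)) (νt : ℝ → Measure H) : Prop :=
  (∀ t ∈ Icc s D.T, IsFiniteMeasure (νt t)) ∧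
  D.IsKernel s ν νt ∧ D.DriftIntegrable ν ∧
  ∀ u ∈ D.EA, (∀ p : ℝ × H, p.1 ∈ Icc 0 D.T → 0 ≤ u p) →
    ∫ t in Icc s D.T, (∫ y, D.Lzero u (t, y) ∂(νt t)) ≤
      2 * lam * ∫ t in Icc s D.T, (∫ y, u (t, y) ∂(νt t))

/-- The moment condition `∫_s^T ∫_H (|x|⁴ + |F(t,x)|² + |x|⁴|F(t,x)|²) ν_t(dx) dt < ∞`. -/
def moment2 (s : ℝ) (νt : ℝ → Measure H) : Prop :=
  ∫⁻ t in Icc s D.T, (∫⁻ y, (ENNReal.ofReal (‖y‖ ^ 4) + (D.FnormE (t, y)) ^ 2 +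
    ENNReal.ofReal (‖y‖ ^ 4) * (D.FnormE (t, y)) ^ 2) ∂(νt t)) < ⊤

/-- The moment condition `∫_s^T ∫_H (|x|² + |F(t,x)| + |x|²|F(t,x)|) ν_t(dx) dt < ∞`. -/
def moment1 (s : ℝ) (νt : ℝ → Measure H) : Prop :=
  ∫⁻ t in Icc s D.T, (∫⁻ y, (ENNReal.ofReal (‖y‖ ^ 2) + D.FnormE (t, y) +
    ENNReal.ofReal (‖y‖ ^ 2) * D.FnormE (t, y)) ∂(νt t)) < ⊤

/-- Hypothesis 3.1: dissipativity of `A`, trace class `Q_t = ∫_0^t e^{sA} C e^{sA*} ds`,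
and the smoothing condition `e^{tA}(H) ⊆ Q_t^{1/2}(H)` with `Λ_t := (Q_t^{1/2})^{-1} e^{tA}`
satisfying `∫_0^∞ e^{-λt} ‖Λ_t‖ dt < ∞` for `λ` large enough. -/
structure Hyp31 where
  ω : ℝ
  A_diss : ∀ x : D.A.domain, ⟪D.A x, (x : H)⟫_ℝ ≤ ω * ‖(x : H)‖ ^ 2
  Q : ℝ → H →L[ℝ] H
  Q_def : ∀ t : ℝ, 0 < t → ∀ x : H,
    Q t x = ∫ r in (0 : ℝ)..t, D.S r (D.C ((ContinuousLinearMap.adjoint (D.S r)) x))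
  Q_pos : ∀ t : ℝ, 0 < t → (Q t).IsPositive
  Q_traceClass : ∀ t : ℝ, 0 < t → Summable fun i : D.ι => ⟪Q t (D.basis i), D.basis i⟫_ℝ
  sqrtQ : ℝ → H →L[ℝ] H
  sqrtQ_pos : ∀ t : ℝ, 0 < t → (sqrtQ t).IsPositive
  sqrtQ_sq : ∀ t : ℝ, 0 < t → (sqrtQ t).comp (sqrtQ t) = Q t
  range_incl : ∀ t : ℝ, 0 < t → Set.range (D.S t) ⊆ Set.range (sqrtQ t)
  Λ : ℝ → H →L[ℝ] H
  Λ_spec : ∀ t : ℝ, 0 < t → (sqrtQ t).comp (Λ t) = D.S t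
  lam₀ : ℝ
  Λ_int : ∀ lam : ℝ, lam₀ ≤ lam →
    IntegrableOn (fun t => Real.exp (-lam * t) * ‖Λ t‖) (Ioi 0)

/-- Hypothesis 5.1: `F(t,·)` is the minimal section of an `m`-dissipative graph
`F̄(t,·)`, with `F(t,0) = 0`. -/
structure Hyp51 where
  Fbar : ℝ → H → Set H
  dom_meas : ∀ t ∈ Icc 0 D.T, MeasurableSet {x : H | (Fbar t x).Nonempty}
  K : ℝ
  K_pos : 0 < K
  diss : ∀ t ∈ Icc 0 D.T, ∀ x y u v : H, u ∈ Fbar t x → v ∈ Fbar t y →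
    ⟪u - v, x - y⟫_ℝ ≤ K * ‖x - y‖ ^ 2
  mrange : ∀ t ∈ Icc 0 D.T, ∀ lam : ℝ, K < lam → ∀ z : H,
    ∃ x : H, ∃ w ∈ Fbar t x, lam • x - w = z
  dom_eq : ∀ t ∈ Icc 0 D.T, ∀ x : H, (t, x) ∈ D.DF ↔ (Fbar t x).Nonempty
  minimal : ∀ t ∈ Icc 0 D.T, ∀ x : H, (t, x) ∈ D.DF →
    D.F (t, x) ∈ Fbar t x ∧ ∀ w ∈ Fbar t x, ‖D.F (t, x)‖ ≤ ‖w‖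
  zero_mem : ∀ t ∈ Icc 0 D.T, (t, (0 : H)) ∈ D.DF ∧ D.F (t, 0) = 0

/-- Hypothesis 3.3 for a drift `F₀ : [0,T] × H → H`: continuity, continuous space
derivative, and uniform Lipschitz continuity in the space variable. -/
def Hyp33 (F0 : ℝ × H → H) : Prop :=
  ContinuousOn F0 (Icc 0 D.T ×ˢ (univ : Set H)) ∧
  (∀ t ∈ Icc 0 D.T, ∀ x : H, DifferentiableAt ℝ (fun y => F0 (t, y)) x) ∧
  (∀ t ∈ Icc 0 D.T, Continuous fun x : H => fderiv ℝ (fun y => F0 (t, y)) x) ∧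
  ∃ K > 0, ∀ t ∈ Icc 0 D.T, ∀ x y : H, ‖F0 (t, x) - F0 (t, y)‖ ≤ K * ‖x - y‖

/-- The data of the Ornstein–Uhlenbeck semigroup: the Gaussian measures `N_{Q_t}`
(specified through their characteristic functionals). -/
structure OUData (hyp : D.Hyp31) where
  N : ℝ → Measure H
  N_prob : ∀ t : ℝ, 0 ≤ t → IsProbabilityMeasure (N t)
  N_zero : N 0 = Measure.dirac 0
  N_char : ∀ t : ℝ, 0 < t → ∀ h : H,
    ∫ x, Complex.exp ((⟪x, h⟫_ℝ : ℂ) * Complex.I) ∂(N t) =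
      Complex.exp (-((⟪hyp.Q t h, h⟫_ℝ : ℂ)) / 2)

end FPData

namespace FPData.OUData

variable {H : Type} [NormedAddCommGroup H] [InnerProductSpace ℝ H] [CompleteSpace H]
  [SecondCountableTopology H] [MeasurableSpace H] [BorelSpace H]
  {D : FPData H} {hyp : D.Hyp31}

/-- The Ornstein–Uhlenbeck semigroup `R_t φ(x) = ∫_H φ(e^{tA} x + y) N_{Q_t}(dy)`. -/
def Rop (O : D.OUData hyp) (t : ℝ) (φ : H → ℝ) (x : H) : ℝ :=
  ∫ y, φ (D.S t x + y) ∂(O.N t)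

/-- The resolvent `G̃_λ f(x) = ∫_0^∞ e^{-λt} R_t f(x) dt` of the OU semigroup. -/
def Gtilde (O : D.OUData hyp) (lam : ℝ) (f : H → ℝ) (x : H) : ℝ :=
  ∫ t in Ioi (0 : ℝ), Real.exp (-lam * t) * O.Rop t f x

/-- The resolvent `G_λ f(t,x) = ∫_t^T e^{-λ(r-t)} R_{r-t} f(r,·)(x) dr` of the
time-dependent OU operator `V`; by definition `u ∈ D(V)` iff `u = G_λ f` for some `λ` and
some `f ∈ C([0,T]; C_{u,2}(H))`, and then `Vu = λu - f`. -/
def Gop (O : D.OUData hyp) (lam : ℝ) (f : ℝ → H → ℝ) (p : ℝ × H) : ℝ :=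
  ∫ r in p.1..D.T, Real.exp (-lam * (r - p.1)) * O.Rop (r - p.1) (f r) p.2

end FPData.OUData

section Spaces

variable {H : Type} [NormedAddCommGroup H] [InnerProductSpace ℝ H] [CompleteSpace H]

/-- Membership in `C_{u,2}(H)`: `x ↦ φ(x)/(1+|x|²)` is uniformly continuous and bounded. -/
def MemCu2 (φ : H → ℝ) : Prop :=
  UniformContinuous (fun x : H => φ x / (1 + ‖x‖ ^ 2)) ∧
    ∃ M : ℝ, ∀ x : H, |φ x| ≤ M * (1 + ‖x‖ ^ 2)

/-- The norm of `C_{u,2}(H)`: `‖φ‖ = sup_x |φ(x)|/(1+|x|²)`. -/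
def cu2Norm (φ : H → ℝ) : ℝ := ⨆ x : H, |φ x| / (1 + ‖x‖ ^ 2)

/-- The sup norm `‖f‖_∞ = sup_x |f(x)|`. -/
def supNorm (f : H → ℝ) : ℝ := ⨆ x : H, |f x|

/-- Membership in `C¹_u(H)`: bounded and uniformly continuous together with the
(Fréchet) derivative. -/
def MemC1u (φ : H → ℝ) : Prop :=
  UniformContinuous φ ∧ (∃ M : ℝ, ∀ x : H, |φ x| ≤ M) ∧ Differentiable ℝ φ ∧
    UniformContinuous (gradient φ) ∧ ∃ M : ℝ, ∀ x : H, ‖gradient φ x‖ ≤ M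

/-- Membership in `C_u(H,H)`: bounded and uniformly continuous `H → H`. -/
def MemCuHH (Φ : H → H) : Prop := UniformContinuous Φ ∧ ∃ M : ℝ, ∀ x : H, ‖Φ x‖ ≤ M

end Spaces

namespace FPData

variable {H : Type} [NormedAddCommGroup H] [InnerProductSpace ℝ H] [CompleteSpace H]
  [SecondCountableTopology H] [MeasurableSpace H] [BorelSpace H] (D : FPData H)

/-- Membership in `C([0,T]; C_{u,2}(H))`. -/
def MemCT (f : ℝ → H → ℝ) : Prop :=
  (∀ t ∈ Icc 0 D.T, MemCu2 (f t)) ∧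
  ∀ t₀ ∈ Icc 0 D.T, ∀ ε > 0, ∃ δ > 0, ∀ t ∈ Icc 0 D.T, |t - t₀| < δ →
    ∀ x : H, |f t x - f t₀ x| ≤ ε * (1 + ‖x‖ ^ 2)

/-- Membership in `C([0,T]; C¹_u(H))`. -/
def MemCTC1u (f : ℝ → H → ℝ) : Prop :=
  (∀ t ∈ Icc 0 D.T, MemC1u (f t)) ∧
  ∀ t₀ ∈ Icc 0 D.T, ∀ ε > 0, ∃ δ > 0, ∀ t ∈ Icc 0 D.T, |t - t₀| < δ →
    ∀ x : H, |f t x - f t₀ x| + ‖gradient (f t) x - gradient (f t₀) x‖ ≤ ε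

/-- `D_x u ∈ C([0,T]; C_u(H,H))`. -/
def GradInCTCuHH (u : ℝ × H → ℝ) : Prop :=
  (∀ t ∈ Icc 0 D.T, MemCuHH fun x : H => xGrad u (t, x)) ∧
  ∀ t₀ ∈ Icc 0 D.T, ∀ ε > 0, ∃ δ > 0, ∀ t ∈ Icc 0 D.T, |t - t₀| < δ →
    ∀ x : H, ‖xGrad u (t, x) - xGrad u (t₀, x)‖ ≤ ε

end FPData

end

set_option linter.unusedSectionVars false

section L1Closure

variable {X : Type*} [MeasurableSpace X]

/-- The closure in `L¹(μ)` of a linear space `S` of functions. -/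
def l1Closure (μ : Measure X) (S : Submodule ℝ (X → ℝ)) : Submodule ℝ (X → ℝ) where
  carrier := {f | Integrable f μ ∧ ∀ ε > 0, ∃ g ∈ S, Integrable g μ ∧ ∫ p, |f p - g p| ∂μ < ε}
  zero_mem' := ⟨integrable_zero _ _ _, fun ε hε =>
    ⟨0, S.zero_mem, integrable_zero _ _ _, by simpa using hε⟩⟩
  add_mem' := by
    rintro f₁ f₂ ⟨h₁, H₁⟩ ⟨h₂, H₂⟩
    refine ⟨h₁.add h₂, fun ε hε => ?_⟩
    obtain ⟨g₁, m₁, i₁, l₁⟩ := H₁ (ε / 2) (by positivity)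
    obtain ⟨g₂, m₂, i₂, l₂⟩ := H₂ (ε / 2) (by positivity)
    refine ⟨g₁ + g₂, S.add_mem m₁ m₂, i₁.add i₂, ?_⟩
    calc ∫ p, |(f₁ + f₂) p - (g₁ + g₂) p| ∂μ
        ≤ ∫ p, (|f₁ p - g₁ p| + |f₂ p - g₂ p|) ∂μ := by
          refine integral_mono ((h₁.add h₂).sub (i₁.add i₂)).abs
            ((h₁.sub i₁).abs.add (h₂.sub i₂).abs) fun p => ?_
          simp only [Pi.add_apply]
          rw [add_sub_add_comm]
          exact abs_add_le _ _
      _ = ∫ p, |f₁ p - g₁ p| ∂μ + ∫ p, |f₂ p - g₂ p| ∂μ :=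
          integral_add (h₁.sub i₁).abs (h₂.sub i₂).abs
      _ < ε := by linarith
  smul_mem' := by
    rintro c f ⟨h, hf⟩
    refine ⟨h.smul c, fun ε hε => ?_⟩
    obtain ⟨g, m, i, l⟩ := hf (ε / (|c| + 1)) (by positivity)
    refine ⟨c • g, S.smul_mem c m, i.smul c, ?_⟩
    simp only [Pi.smul_apply, smul_eq_mul, ← mul_sub, abs_mul]
    rw [integral_const_mul]
    rw [lt_div_iff₀ (by positivity)] at l
    have : 0 ≤ ∫ p, |f p - g p| ∂μ := integral_nonneg fun _ => abs_nonneg _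
    nlinarith [abs_nonneg c]

variable {μ : Measure X} {S : Submodule ℝ (X → ℝ)} {f g : X → ℝ}

theorem mem_l1Closure_of_mem (hf : f ∈ S) (hi : Integrable f μ) : f ∈ l1Closure μ S :=
  ⟨hi, fun ε hε => ⟨f, hf, hi, by simpa using hε⟩⟩

theorem mem_l1Closure_of_approx (hi : Integrable f μ)
    (h : ∀ ε > 0, ∃ g ∈ l1Closure μ S, ∫ p, |f p - g p| ∂μ < ε) : f ∈ l1Closure μ S := by
  refine ⟨hi, fun ε hε => ?_⟩
  obtain ⟨g, ⟨ig, hg⟩, l⟩ := h (ε / 2) (by positivity)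
  obtain ⟨k, mk, ik, lk⟩ := hg (ε / 2) (by positivity)
  refine ⟨k, mk, ik, ?_⟩
  calc ∫ p, |f p - k p| ∂μ ≤ ∫ p, (|f p - g p| + |g p - k p|) ∂μ :=
        integral_mono (hi.sub ik).abs ((hi.sub ig).abs.add (ig.sub ik).abs)
          fun p => abs_sub_le _ _ _
    _ = ∫ p, |f p - g p| ∂μ + ∫ p, |g p - k p| ∂μ :=
        integral_add (hi.sub ig).abs (ig.sub ik).abs
    _ < ε := by linarith

theorem mem_l1Closure_congr (hf : f ∈ l1Closure μ S) (h : f =ᵐ[μ] g) : g ∈ l1Closure μ S := by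
  refine mem_l1Closure_of_approx (hf.1.congr h) fun ε hε => ⟨f, hf, ?_⟩
  rw [integral_eq_zero_of_ae]
  · exact hε
  · filter_upwards [h] with p hp
    simp [hp]

theorem mem_l1Closure_of_dominated {F : ℕ → X → ℝ} {b : X → ℝ}
    (hF : ∀ n, F n ∈ l1Closure μ S) (hb : Integrable b μ) (hFb : ∀ n, ∀ᵐ p ∂μ, |F n p| ≤ b p)
    (hlim : ∀ᵐ p ∂μ, Tendsto (fun n => F n p) atTop (𝓝 (f p))) : f ∈ l1Closure μ S := by
  have hfm : AEStronglyMeasurable f μ :=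
    aestronglyMeasurable_of_tendsto_ae atTop (fun n => (hF n).1.1) hlim
  have hfb : ∀ᵐ p ∂μ, |f p| ≤ b p := by
    filter_upwards [ae_all_iff.2 hFb, hlim] with p h1 h2
    exact le_of_tendsto h2.abs (Eventually.of_forall h1)
  have hfi : Integrable f μ := hb.mono' hfm hfb
  refine mem_l1Closure_of_approx hfi fun ε hε => ?_
  have key : Tendsto (fun n => ∫ p, |f p - F n p| ∂μ) atTop (𝓝 (∫ _, (0 : ℝ) ∂μ)) := by
    refine tendsto_integral_of_dominated_convergence (fun p => b p + b p)
      (fun n => (hfi.sub (hF n).1).abs.1) (hb.add hb) (fun n => ?_) ?_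
    · filter_upwards [hfb, hFb n] with p h1 h2
      rw [Real.norm_eq_abs, abs_abs]
      exact (abs_sub _ _).trans (add_le_add h1 h2)
    · filter_upwards [hlim] with p hp
      simpa using (hp.const_sub (f p)).abs
  rw [integral_zero] at key
  obtain ⟨n, hn⟩ := (key.eventually (gt_mem_nhds hε)).exists
  exact ⟨F n, hF n, hn⟩

end L1Closure

section TrigDense

variable {E : Type*} [NormedAddCommGroup E] [InnerProductSpace ℝ E]

/-- The linear span of `x ↦ cos ⟨x, h⟩` and `x ↦ sin ⟨x, h⟩` with frequencies `h ∈ K`. -/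
def trigSpan (K : Set E) : Submodule ℝ (E → ℝ) :=
  Submodule.span ℝ {f | ∃ h ∈ K, f = (fun x => Real.cos ⟪x, h⟫_ℝ) ∨
    f = fun x => Real.sin ⟪x, h⟫_ℝ}

variable [CompleteSpace E] [SecondCountableTopology E] [MeasurableSpace E] [BorelSpace E]

theorem memLp_of_mem_trigSpan {K : Set E} {ν : Measure E} [IsFiniteMeasure ν] {f : E → ℝ}
    (hf : f ∈ trigSpan K) (p : ℝ≥0∞) : MemLp f p ν := by
  induction hf using Submodule.span_induction with
  | mem f hf =>
    obtain ⟨h, -, rfl | rfl⟩ := hf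
    · exact MemLp.of_bound (by fun_prop) 1
        (Eventually.of_forall fun x => Real.abs_cos_le_one _)
    · exact MemLp.of_bound (by fun_prop) 1
        (Eventually.of_forall fun x => Real.abs_sin_le_one _)
  | zero => exact MemLp.zero'
  | add f g _ _ hf hg => exact hf.add hg
  | smul c f _ hf => exact hf.const_smul c

theorem continuous_integral_comp_inner {ν : Measure E} {g : E → ℝ} (hg : Integrable g ν)
    {φ : ℝ → ℝ} (hφ : Continuous φ) (hb : ∀ r, |φ r| ≤ 1) :
    Continuous fun h => ∫ x, g x * φ ⟪x, h⟫_ℝ ∂ν := by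
  refine continuous_of_dominated (bound := fun x => |g x|) (fun h => ?_) (fun h => ?_) hg.abs ?_
  · exact hg.1.mul (by fun_prop)
  · refine Eventually.of_forall fun x => ?_
    rw [Real.norm_eq_abs, abs_mul]
    exact mul_le_of_le_one_right (abs_nonneg _) (hb _)
  · exact Eventually.of_forall fun x => by fun_prop

theorem ae_eq_zero_of_integral_trig {ν : Measure E} [IsFiniteMeasure ν] {g : E → ℝ}
    (hg : Integrable g ν)
    (hc : ∀ h : E, ∫ x, g x * Real.cos ⟪x, h⟫_ℝ ∂ν = 0)
    (hs : ∀ h : E, ∫ x, g x * Real.sin ⟪x, h⟫_ℝ ∂ν = 0) : g =ᵐ[ν] 0 := by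
  have hchar : ∀ k : E → ℝ, Integrable k ν → (∀ x, 0 ≤ k x) → ∀ h,
      charFun (ν.withDensity fun x => ENNReal.ofReal (k x)) h =
        ((∫ x, k x * Real.cos ⟪x, h⟫_ℝ ∂ν : ℝ) : ℂ) +
          ((∫ x, k x * Real.sin ⟪x, h⟫_ℝ ∂ν : ℝ) : ℂ) * Complex.I := by
    intro k hk hk0 h
    have ic : Integrable (fun x => k x * Real.cos ⟪x, h⟫_ℝ) ν :=
      hk.mul_bdd (c := 1) (by fun_prop) (Eventually.of_forall fun x => Real.abs_cos_le_one _)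
    have is : Integrable (fun x => k x * Real.sin ⟪x, h⟫_ℝ) ν :=
      hk.mul_bdd (c := 1) (by fun_prop) (Eventually.of_forall fun x => Real.abs_sin_le_one _)
    rw [charFun_apply, integral_withDensity_eq_integral_toReal_smul₀
      hk.1.aemeasurable.ennreal_ofReal (Eventually.of_forall fun x => ENNReal.ofReal_lt_top),
      ← integral_complex_ofReal, ← integral_complex_ofReal, ← integral_mul_const,
      ← integral_add ic.ofReal (is.ofReal.mul_const _)]
    refine integral_congr_ae (Eventually.of_forall fun x => ?_)
    simp only [ENNReal.toReal_ofReal (hk0 x), Complex.exp_mul_I, Complex.real_smul]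
    push_cast
    ring
  have hpos : Integrable (fun x => max (g x) 0) ν := hg.pos_part
  have hneg : Integrable (fun x => max (-g x) 0) ν := hg.neg_part
  have hsplit : ∀ φ : ℝ → ℝ, Continuous φ → (∀ r, |φ r| ≤ 1) → ∀ h : E,
      ∫ x, g x * φ ⟪x, h⟫_ℝ ∂ν = 0 →
      ∫ x, max (g x) 0 * φ ⟪x, h⟫_ℝ ∂ν = ∫ x, max (-g x) 0 * φ ⟪x, h⟫_ℝ ∂ν := by
    intro φ hφ hb h h0
    rw [← sub_eq_zero, ← integral_sub]
    · refine Eq.trans (integral_congr_ae (Eventually.of_forall fun x => ?_)) h0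
      simp only [← sub_mul]
      congr 1
      rcases le_total (g x) (0 : ℝ) with hx | hx
      · rw [max_eq_right hx, max_eq_left (by linarith)]; ring
      · rw [max_eq_left hx, max_eq_right (by linarith)]; ring
    · exact hpos.mul_bdd (c := 1) (by fun_prop) (Eventually.of_forall fun x => hb _)
    · exact hneg.mul_bdd (c := 1) (by fun_prop) (Eventually.of_forall fun x => hb _)
  have : IsFiniteMeasure (ν.withDensity fun x => ENNReal.ofReal (max (g x) 0)) :=
    isFiniteMeasure_withDensity_ofReal hpos.2
  have : IsFiniteMeasure (ν.withDensity fun x => ENNReal.ofReal (max (-g x) 0)) :=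
    isFiniteMeasure_withDensity_ofReal hneg.2
  have heq : (ν.withDensity fun x => ENNReal.ofReal (max (g x) 0)) =
      ν.withDensity fun x => ENNReal.ofReal (max (-g x) 0) := by
    refine Measure.ext_of_charFun (funext fun h => ?_)
    rw [hchar _ hpos (fun x => le_max_right _ _), hchar _ hneg (fun x => le_max_right _ _),
      hsplit _ Real.continuous_cos Real.abs_cos_le_one h (hc h),
      hsplit _ Real.continuous_sin Real.abs_sin_le_one h (hs h)]
  have hae := (withDensity_eq_iff hpos.1.aemeasurable.ennreal_ofReal
    hneg.1.aemeasurable.ennreal_ofReal (by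
      simpa using (hasFiniteIntegral_iff_ofReal
        (Eventually.of_forall fun x => le_max_right (g x) 0)).1 hpos.2 |>.ne)).1 heq
  filter_upwards [hae] with x hx
  rw [ENNReal.ofReal_eq_ofReal_iff (le_max_right _ _) (le_max_right _ _)] at hx
  simp only [Pi.zero_apply]
  rcases le_total (g x) 0 with h | h
  · rw [max_eq_right h, max_eq_left (by linarith)] at hx; linarith
  · rw [max_eq_left h, max_eq_right (by linarith)] at hx; linarith

theorem exists_trigSpan_integral_sub_lt {K : Set E} (hK : Dense K) {ν : Measure E}
    [IsFiniteMeasure ν] {f : E → ℝ} (hf : Integrable f ν) {ε : ℝ} (hε : 0 < ε) :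
    ∃ g ∈ trigSpan K, ∫ x, |f x - g x| ∂ν < ε := by
  let W : Submodule ℝ (Lp ℝ 2 ν) :=
    { carrier := {F | ∃ g ∈ trigSpan K, F =ᵐ[ν] g}
      zero_mem' := ⟨0, Submodule.zero_mem _, Lp.coeFn_zero _ _ _⟩
      add_mem' := by
        rintro F G ⟨f, hf, hF⟩ ⟨g, hg, hG⟩
        exact ⟨f + g, Submodule.add_mem _ hf hg, (Lp.coeFn_add F G).trans (hF.add hG)⟩
      smul_mem' := by
        rintro c F ⟨f, hf, hF⟩
        exact ⟨c • f, Submodule.smul_mem _ c hf, (Lp.coeFn_smul c F).trans (hF.const_smul c)⟩ }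
  have hW : W.topologicalClosure = ⊤ := by
    rw [Submodule.topologicalClosure_eq_top_iff, Submodule.eq_bot_iff]
    intro G hG
    have hGi : Integrable G ν := (Lp.memLp G).integrable (by norm_num)
    have horth : ∀ k ∈ trigSpan K, ∫ x, G x * k x ∂ν = 0 := by
      intro k hk
      have hkL := memLp_of_mem_trigSpan (ν := ν) hk 2
      have := hG (hkL.toLp k) ⟨k, hk, hkL.coeFn_toLp⟩
      rw [L2.inner_def] at this
      rw [← this]
      refine integral_congr_ae ?_
      filter_upwards [hkL.coeFn_toLp] with x hx
      rw [hx]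
      simp
    have hall : ∀ φ : ℝ → ℝ, Continuous φ → (∀ r, |φ r| ≤ 1) →
        (∀ h ∈ K, (fun x => φ ⟪x, h⟫_ℝ) ∈ trigSpan K) →
        ∀ h : E, ∫ x, G x * φ ⟪x, h⟫_ℝ ∂ν = 0 := by
      intro φ hφ hb hm h
      refine congrFun (Continuous.ext_on hK (continuous_integral_comp_inner hGi hφ hb)
        continuous_const fun h hh => ?_) h
      exact horth _ (hm h hh)
    have := ae_eq_zero_of_integral_trig hGi
      (hall _ Real.continuous_cos Real.abs_cos_le_one fun h hh =>
        Submodule.subset_span ⟨h, hh, Or.inl rfl⟩)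
      (hall _ Real.continuous_sin Real.abs_sin_le_one fun h hh =>
        Submodule.subset_span ⟨h, hh, Or.inr rfl⟩)
    exact (Lp.eq_zero_iff_ae_eq_zero).2 this
  obtain ⟨b, hb, hbi⟩ := hf.exists_boundedContinuous_integral_sub_le (half_pos hε)
  have hbL : MemLp b 2 ν := MemLp.of_bound b.continuous.aestronglyMeasurable ‖b‖
    (Eventually.of_forall b.norm_coe_le_norm)
  have hcl : hbL.toLp b ∈ closure (W : Set (Lp ℝ 2 ν)) := by
    rw [← Submodule.topologicalClosure_coe, hW]
    trivial
  let C : ℝ := (ν.real univ) ^ (1 / 2 : ℝ)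
  have hC : 0 ≤ C := by positivity
  obtain ⟨G, ⟨g, hg, hGg⟩, hd⟩ := Metric.mem_closure_iff.1 hcl (ε / 2 / (C + 1)) (by positivity)
  refine ⟨g, hg, ?_⟩
  have hgL := memLp_of_mem_trigSpan (ν := ν) hg 2
  have hgi : Integrable g ν := hgL.integrable (by norm_num)
  have hbg : ∫ x, |b x - g x| ∂ν < ε / 2 := by
    have hm : MemLp (fun x => b x - g x) 2 ν := hbL.sub hgL
    have h1 : ∫ x, |b x - g x| ∂ν = (eLpNorm (fun x => b x - g x) 1 ν).toReal := by
      rw [eLpNorm_one_eq_lintegral_enorm, ← integral_norm_eq_lintegral_enorm hm.1]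
      rfl
    have h2 : dist (hbL.toLp b) G = (eLpNorm (fun x => b x - g x) 2 ν).toReal := by
      rw [Lp.dist_def]
      congr 1
      refine eLpNorm_congr_ae ?_
      filter_upwards [hbL.coeFn_toLp, hGg] with x h1 h2
      simp [h1, h2]
    have h3 := eLpNorm_le_eLpNorm_mul_rpow_measure_univ (μ := ν) (p := 1) (q := 2)
      (by norm_num) hm.1
    have h4 : (eLpNorm (fun x => b x - g x) 1 ν).toReal ≤
        (eLpNorm (fun x => b x - g x) 2 ν).toReal * C := by
      refine (ENNReal.toReal_mono ?_ h3).trans_eq ?_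
      · exact ENNReal.mul_ne_top hm.2.ne
          (ENNReal.rpow_ne_top_of_nonneg (by norm_num) (measure_ne_top _ _))
      · rw [ENNReal.toReal_mul, ← ENNReal.toReal_rpow]
        simp only [C, Measure.real]
        norm_num
    rw [h2, lt_div_iff₀ (by positivity)] at hd
    rw [h1]
    have : 0 ≤ (eLpNorm (fun x => b x - g x) 2 ν).toReal := ENNReal.toReal_nonneg
    nlinarith
  have hfb : Integrable (fun x => |f x - b x|) ν := (hf.sub hbi).abs
  have hbgi : Integrable (fun x => |b x - g x|) ν := (hbi.sub hgi).abs
  calc ∫ x, |f x - g x| ∂ν ≤ ∫ x, (|f x - b x| + |b x - g x|) ∂ν :=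
        integral_mono (hf.sub hgi).abs (hfb.add hbgi) fun p => abs_sub_le _ _ _
    _ = ∫ x, |f x - b x| ∂ν + ∫ x, |b x - g x| ∂ν := integral_add hfb hbgi
    _ < ε := by
      have : ∫ x, |f x - b x| ∂ν ≤ ε / 2 := hb
      linarith

end TrigDense

namespace FPData

variable {H : Type} [NormedAddCommGroup H] [InnerProductSpace ℝ H] [CompleteSpace H]
  [SecondCountableTopology H] [MeasurableSpace H] [BorelSpace H] (D : FPData H)

theorem exists_norm_S_le (t : ℝ) : ∃ M : ℝ, 0 ≤ M ∧ ∀ r ∈ Icc 0 t, ‖D.S r‖ ≤ M := by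
  obtain ⟨M, hM⟩ := banach_steinhaus (g := fun r : Icc (0 : ℝ) t => D.S r) fun x => by
    obtain ⟨C, hC⟩ := isCompact_Icc.exists_bound_of_continuousOn
      ((D.S_cont x).mono (Icc_subset_Ici_self : Icc 0 t ⊆ Ici 0))
    exact ⟨C, fun r => hC r r.2⟩
  exact ⟨max M 0, le_max_right _ _, fun r hr => (hM ⟨r, hr⟩).trans (le_max_left _ _)⟩

theorem intervalIntegrable_inner_S (y x : H) {t : ℝ} (ht : 0 ≤ t) :
    IntervalIntegrable (fun r => ⟪y, D.S r x⟫_ℝ) volume 0 t := by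
  refine ContinuousOn.intervalIntegrable ?_
  rw [uIcc_of_le ht]
  exact continuousOn_const.inner ((D.S_cont x).mono Icc_subset_Ici_self)

theorem integral_S_A (x : D.A.domain) {t : ℝ} (ht : 0 ≤ t) :
    ∫ r in (0 : ℝ)..t, D.S r (D.A x) = D.S t x - x := by
  rw [intervalIntegral.integral_eq_sub_of_hasDeriv_right (f := fun r => D.S r x), D.S_zero]
  · rfl
  · rw [uIcc_of_le ht]
    exact (D.S_cont x).mono Icc_subset_Ici_self
  · intro r hr
    rw [min_eq_left ht] at hr
    rw [hasDerivWithinAt_iff_tendsto_slope' (by simp)]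
    have h1 : Tendsto (fun q : ℝ => q - r) (𝓝[>] r) (𝓝[>] 0) := by
      refine tendsto_nhdsWithin_iff.2 ⟨?_, ?_⟩
      · have : Tendsto (fun q : ℝ => q - r) (𝓝 r) (𝓝 (r - r)) :=
          (continuous_sub_right r).tendsto r
        rw [sub_self] at this
        exact this.mono_left nhdsWithin_le_nhds
      · filter_upwards [self_mem_nhdsWithin] with q hq
        exact sub_pos.2 (mem_Ioi.1 hq)
    refine (((D.S r).continuous.tendsto _).comp ((D.A_gen x).comp h1)).congr' ?_
    filter_upwards [self_mem_nhdsWithin] with q hq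
    have hq' : r < q := hq
    have := D.S_add r (q - r) hr.1.le (sub_nonneg.2 hq'.le)
    rw [add_sub_cancel] at this
    simp [slope, this]
  · refine ContinuousOn.intervalIntegrable ?_
    rw [uIcc_of_le ht]
    exact (D.S_cont _).mono Icc_subset_Ici_self

/-- The weak integral `∫₀ᵗ S(r)* y dr`, which lies in `D(A*)`. -/
theorem exists_adjoint_domain_inner_eq (y : H) {t : ℝ} (ht : 0 ≤ t) :
    ∃ w ∈ D.A.adjoint.domain, ∀ x : H, ⟪w, x⟫_ℝ = ∫ r in (0 : ℝ)..t, ⟪y, D.S r x⟫_ℝ := by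
  obtain ⟨M, hM0, hM⟩ := D.exists_norm_S_le t
  let ℓ : H →L[ℝ] ℝ := LinearMap.mkContinuous
    { toFun := fun x => ∫ r in (0 : ℝ)..t, ⟪y, D.S r x⟫_ℝ
      map_add' := fun x z => by
        simp only [map_add, inner_add_right]
        exact intervalIntegral.integral_add (D.intervalIntegrable_inner_S y x ht)
          (D.intervalIntegrable_inner_S y z ht)
      map_smul' := fun c x => by
        simp [inner_smul_right] } (‖y‖ * M * |t - 0|) fun x => by
      refine (intervalIntegral.norm_integral_le_of_norm_le_const
        (C := ‖y‖ * M * ‖x‖) fun r hr => ?_).trans_eq (by ring)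
      rw [uIoc_of_le ht] at hr
      refine (norm_inner_le_norm _ _).trans ?_
      rw [mul_assoc]
      gcongr
      exact (D.S r).le_of_opNorm_le (hM r ⟨hr.1.le, hr.2⟩) x
  have hw : ∀ x, ⟪(InnerProductSpace.toDual ℝ H).symm ℓ, x⟫_ℝ =
      ∫ r in (0 : ℝ)..t, ⟪y, D.S r x⟫_ℝ := fun x => by
    rw [InnerProductSpace.toDual_symm_apply]
    rfl
  refine ⟨_, LinearPMap.mem_adjoint_domain_of_exists _
    ⟨ContinuousLinearMap.adjoint (D.S t) y - y, fun x => ?_⟩, hw⟩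
  rw [hw, inner_sub_left, ContinuousLinearMap.adjoint_inner_left, ← inner_sub_right,
    ← D.integral_S_A x ht]
  refine ((innerSL ℝ y).intervalIntegral_comp_comm ?_).symm
  refine ContinuousOn.intervalIntegrable ?_
  rw [uIcc_of_le ht]
  exact (D.S_cont _).mono Icc_subset_Ici_self

theorem dense_adjoint_domain : Dense (D.A.adjoint.domain : Set H) := by
  rw [Submodule.dense_iff_topologicalClosure_eq_top, Submodule.topologicalClosure_eq_top_iff,
    Submodule.eq_bot_iff]
  intro z hz
  have hcont : ContinuousOn (fun r => ⟪z, D.S r z⟫_ℝ) (Ici 0) :=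
    continuousOn_const.inner (D.S_cont z)
  have hint : ∀ t : ℝ, 0 ≤ t → ∫ r in (0 : ℝ)..t, ⟪z, D.S r z⟫_ℝ = 0 := fun t ht => by
    obtain ⟨w, hw, hwz⟩ := D.exists_adjoint_domain_inner_eq z ht
    rw [← hwz]
    exact hz w hw
  have h1 : HasDerivWithinAt (fun t => ∫ r in (0 : ℝ)..t, ⟪z, D.S r z⟫_ℝ) ⟪z, D.S 0 z⟫_ℝ
      (Ici 0) 0 := by
    refine intervalIntegral.integral_hasDerivWithinAt_right
      (D.intervalIntegrable_inner_S z z le_rfl) ?_ ((hcont 0 self_mem_Ici).mono Ioi_subset_Ici_self)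
    exact ⟨Ioi 0, self_mem_nhdsWithin,
      (hcont.mono Ioi_subset_Ici_self).aestronglyMeasurable measurableSet_Ioi⟩
  have h2 : HasDerivWithinAt (fun t => ∫ r in (0 : ℝ)..t, ⟪z, D.S r z⟫_ℝ) 0 (Ici 0) 0 :=
    (hasDerivWithinAt_const (0 : ℝ) (Ici (0 : ℝ)) (0 : ℝ)).congr
      (fun t ht => hint t ht) (hint 0 le_rfl)
  have := (uniqueDiffOn_Ici (0 : ℝ) 0 self_mem_Ici).eq_deriv _ h1 h2
  rw [D.S_zero] at this
  simpa using this

end FPData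

section Extension

variable {E : Type*} [NormedAddCommGroup E] [NormedSpace ℝ E]

/-- A function differentiable on `[a, b]` coincides there with a function that is differentiable
at every point of `[a, b]`, endpoints included. -/
theorem exists_eqOn_Icc_differentiableAt {a b : ℝ} (hab : a < b) {f : ℝ → E}
    (hf : DifferentiableOn ℝ f (Icc a b)) :
    ∃ g : ℝ → E, EqOn g f (Icc a b) ∧ ∀ t ∈ Icc a b, DifferentiableAt ℝ g t := by
  let L : ℝ → ℝ → E := fun c t => f c + (t - c) • derivWithin f (Icc a b) c
  have hL : ∀ c t, HasDerivAt (L c) (derivWithin f (Icc a b) c) t := fun c t => by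
    simpa [L] using (((hasDerivAt_id t).sub_const c).smul_const
      (derivWithin f (Icc a b) c)).const_add (f c)
  let g : ℝ → E := fun t => if t < a then L a t else if t ≤ b then f t else L b t
  have hg : EqOn g f (Icc a b) := fun t ht => by simp [g, not_lt.2 ht.1, ht.2]
  have hfd : ∀ t ∈ Icc a b, HasDerivWithinAt g (derivWithin f (Icc a b) t) (Icc a b) t :=
    fun t ht => (hf t ht).hasDerivWithinAt.congr hg (hg ht)
  refine ⟨g, hg, fun t ht => ?_⟩
  rcases eq_or_lt_of_le ht.1 with rfl | hat
  · have h1 : HasDerivWithinAt g (derivWithin f (Icc a b) a) (Iic a) a := by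
      refine (hL a a).hasDerivWithinAt.congr (fun r hr => ?_) (by simp [g, L, hab.le])
      rcases eq_or_lt_of_le (mem_Iic.1 hr) with rfl | h
      · simp [g, L, hab.le]
      · simp [g, h]
    have h2 := h1.union (hfd a ht)
    rw [Iic_union_Icc_eq_Iic hab.le] at h2
    exact (h2.hasDerivAt (Iic_mem_nhds hab)).differentiableAt
  rcases eq_or_lt_of_le ht.2 with rfl | htb
  · have h1 : HasDerivWithinAt g (derivWithin f (Icc a t) t) (Ici t) t := by
      refine (hL t t).hasDerivWithinAt.congr (fun r hr => ?_) (by simp [g, L, hab.le])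
      rcases eq_or_lt_of_le (mem_Ici.1 hr) with rfl | h
      · simp [g, L, hab.le]
      · simp [g, not_le.2 h, not_lt.2 (hab.trans h).le]
    have h2 := (hfd t ht).union h1
    rw [Icc_union_Ici_eq_Ici hab.le] at h2
    exact (h2.hasDerivAt (Ici_mem_nhds hab)).differentiableAt
  · exact ((hfd t ht).hasDerivAt (Icc_mem_nhds hat htb)).differentiableAt

end Extension

section Gradient

variable {E : Type*} [NormedAddCommGroup E] [InnerProductSpace ℝ E] [CompleteSpace E]

theorem gradient_fun_add {f g : E → ℝ} (hf : Differentiable ℝ f) (hg : Differentiable ℝ g) :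
    gradient (fun z => f z + g z) = fun z => gradient f z + gradient g z := by
  ext1 z
  simp [gradient, fderiv_fun_add (hf z) (hg z)]

theorem gradient_fun_const_mul (c : ℝ) (f : E → ℝ) :
    gradient (fun z => c * f z) = fun z => c • gradient f z := by
  ext1 z
  have : fderiv ℝ (fun z => c * f z) z = c • fderiv ℝ f z :=
    congrFun (fderiv_const_smul_field (f := f) c) z
  simp [gradient, this]

theorem hasFDerivAt_inner_left (h z : E) :
    HasFDerivAt (fun z : E => ⟪z, h⟫_ℝ) (innerSL ℝ h) z :=
  (innerSL ℝ h).hasFDerivAt.congr_of_eventuallyEq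
    (Eventually.of_forall fun z => real_inner_comm h z)

theorem gradient_comp_inner {f : ℝ → ℝ} (hf : Differentiable ℝ f) (h : E) :
    gradient (fun z => f ⟪z, h⟫_ℝ) = fun z => deriv f ⟪z, h⟫_ℝ • h := by
  refine gradient_eq fun z => ?_
  rw [hasGradientAt_iff_hasFDerivAt]
  have e : InnerProductSpace.toDual ℝ E (deriv f ⟪z, h⟫_ℝ • h) =
      deriv f ⟪z, h⟫_ℝ • innerSL ℝ h := by
    ext v
    simp
  rw [e]
  exact (hf _).hasDerivAt.comp_hasFDerivAt z (hasFDerivAt_inner_left h z)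

end Gradient

namespace FPData

variable {H : Type} [NormedAddCommGroup H] [InnerProductSpace ℝ H] [CompleteSpace H]
  [SecondCountableTopology H] [MeasurableSpace H] [BorelSpace H] (D : FPData H)

/-- Regularity in the space variable, at times in `[0, T]`, shared by all elements of `E_A`. -/
structure IsRegular (u : ℝ × H → ℝ) : Prop where
  diff : ∀ t ∈ Icc 0 D.T, Differentiable ℝ fun z => u (t, z)
  diff_gradient : ∀ t ∈ Icc 0 D.T, Differentiable ℝ (gradient fun z => u (t, z))
  xGrad_mem : ∀ t ∈ Icc 0 D.T, ∀ x, xGrad u (t, x) ∈ D.A.adjoint.domain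
  summable : ∀ t ∈ Icc 0 D.T, ∀ x, Summable fun i : D.ι =>
    ⟪(fderiv ℝ (gradient fun z => u (t, z)) x) (D.sqrtC (D.basis i)), D.sqrtC (D.basis i)⟫_ℝ

variable {D}

theorem exists_of_mem_EAgen {u : ℝ × H → ℝ} (hu : u ∈ D.EAgen) :
    ∃ (f φ : ℝ → ℝ) (h g : ℝ → H), (f = Real.cos ∨ f = Real.sin) ∧
      ContDiffOn ℝ 1 φ (Icc 0 D.T) ∧ φ D.T = 0 ∧ D.CinDAstar h g ∧
      u = fun p => φ p.1 * f ⟪p.2, h p.1⟫_ℝ := by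
  obtain ⟨φ, h, g, hφ, hT, hg, rfl | rfl⟩ := hu
  · exact ⟨_, φ, h, g, Or.inl rfl, hφ, hT, hg, rfl⟩
  · exact ⟨_, φ, h, g, Or.inr rfl, hφ, hT, hg, rfl⟩

theorem mem_EA_of_cos_or_sin {f φ : ℝ → ℝ} {h g : ℝ → H} (hf : f = Real.cos ∨ f = Real.sin)
    (hφ : ContDiffOn ℝ 1 φ (Icc 0 D.T)) (hT : φ D.T = 0) (hg : D.CinDAstar h g) :
    (fun p : ℝ × H => φ p.1 * f ⟪p.2, h p.1⟫_ℝ) ∈ D.EA := by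
  refine Submodule.subset_span ⟨φ, h, g, hφ, hT, hg, ?_⟩
  rcases hf with rfl | rfl
  · exact Or.inl rfl
  · exact Or.inr rfl

theorem contDiff_of_cos_or_sin {f : ℝ → ℝ} (hf : f = Real.cos ∨ f = Real.sin) :
    ContDiff ℝ 2 f := by
  rcases hf with rfl | rfl
  · exact Real.contDiff_cos
  · exact Real.contDiff_sin

theorem abs_le_one_of_cos_or_sin {f : ℝ → ℝ} (hf : f = Real.cos ∨ f = Real.sin) (r : ℝ) :
    |f r| ≤ 1 := by
  rcases hf with rfl | rfl
  · exact Real.abs_cos_le_one r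
  · exact Real.abs_sin_le_one r

theorem isRegular_of_mem_EAgen {u : ℝ × H → ℝ} (hu : u ∈ D.EAgen) : D.IsRegular u := by
  obtain ⟨f, φ, h, g, hfcs, -, -, ⟨-, -, hg⟩, rfl⟩ := exists_of_mem_EAgen hu
  have hf : ContDiff ℝ 2 f := contDiff_of_cos_or_sin hfcs
  have hfd : Differentiable ℝ f := hf.differentiable (by norm_num)
  have hfd' : Differentiable ℝ (deriv f) := by
    have : ContDiff ℝ (1 + 1) f := by simpa [one_add_one_eq_two] using hf
    exact (contDiff_succ_iff_deriv.1 this).2.2.differentiable (by norm_num)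
  have hgrad : ∀ t, gradient (fun z => φ t * f ⟪z, h t⟫_ℝ) =
      fun z => φ t • deriv f ⟪z, h t⟫_ℝ • h t := fun t => by
    rw [gradient_fun_const_mul, gradient_comp_inner hfd]
  have hgradd : ∀ t x, HasFDerivAt (fun z => φ t • deriv f ⟪z, h t⟫_ℝ • h t)
      (φ t • (deriv (deriv f) ⟪x, h t⟫_ℝ • innerSL ℝ (h t)).smulRight (h t)) x := fun t x =>
    (((hfd' _).hasDerivAt.comp_hasFDerivAt x
      (hasFDerivAt_inner_left (h t) x)).smul_const (h t)).const_smul (φ t)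
  refine ⟨fun t _ => ?_, fun t _ => ?_, fun t ht x => ?_, fun t _ x => ?_⟩
  · exact fun x => ((hfd _).comp x
      (hasFDerivAt_inner_left (h t) x).differentiableAt).const_mul (φ t)
  · simp only [hgrad]
    exact fun x => (hgradd t x).differentiableAt
  · simp only [xGrad, hgrad]
    exact Submodule.smul_mem _ _ (Submodule.smul_mem _ _
      (LinearPMap.mem_domain_of_mem_graph (hg t ht)))
  · simp only [hgrad, (hgradd t x).fderiv]
    have hs := (D.basis.summable_inner_mul_inner (ContinuousLinearMap.adjoint D.sqrtC (h t))
      (ContinuousLinearMap.adjoint D.sqrtC (h t))).mul_left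
        (φ t * deriv (deriv f) ⟪x, h t⟫_ℝ)
    refine hs.congr fun i => ?_
    simp only [ContinuousLinearMap.adjoint_inner_left, ContinuousLinearMap.adjoint_inner_right,
      smul_apply, ContinuousLinearMap.smulRight_apply, innerSL_apply_apply,
      inner_smul_left, real_inner_comm, smul_eq_mul, conj_trivial]
    ring

theorem IsRegular.add {u v : ℝ × H → ℝ} (hu : D.IsRegular u) (hv : D.IsRegular v) :
    D.IsRegular (u + v) := by
  have hgrad : ∀ t ∈ Icc 0 D.T, gradient (fun z => u (t, z) + v (t, z)) =
      fun z => gradient (fun z => u (t, z)) z + gradient (fun z => v (t, z)) z :=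
    fun t ht => gradient_fun_add (hu.diff t ht) (hv.diff t ht)
  refine ⟨fun t ht => (hu.diff t ht).add (hv.diff t ht), fun t ht => ?_, fun t ht x => ?_,
    fun t ht x => ?_⟩
  · simp only [Pi.add_apply, hgrad t ht]
    exact (hu.diff_gradient t ht).add (hv.diff_gradient t ht)
  · simp only [xGrad, Pi.add_apply, hgrad t ht]
    exact Submodule.add_mem _ (hu.xGrad_mem t ht x) (hv.xGrad_mem t ht x)
  · simp only [Pi.add_apply, hgrad t ht,
      fderiv_fun_add (hu.diff_gradient t ht x) (hv.diff_gradient t ht x)]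
    simpa only [add_apply, inner_add_left] using
      (hu.summable t ht x).add (hv.summable t ht x)

theorem IsRegular.const_smul {u : ℝ × H → ℝ} (hu : D.IsRegular u) (c : ℝ) :
    D.IsRegular (c • u) := by
  have hgrad : ∀ t, gradient (fun z => c * u (t, z)) =
      fun z => c • gradient (fun z => u (t, z)) z := fun t => gradient_fun_const_mul c _
  refine ⟨fun t ht => (hu.diff t ht).const_mul c, fun t ht => ?_, fun t ht x => ?_,
    fun t ht x => ?_⟩
  · simp only [Pi.smul_apply, smul_eq_mul, hgrad t]
    exact (hu.diff_gradient t ht).const_smul c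
  · simp only [xGrad, Pi.smul_apply, smul_eq_mul, hgrad t]
    exact Submodule.smul_mem _ _ (hu.xGrad_mem t ht x)
  · simp only [Pi.smul_apply, smul_eq_mul, hgrad t,
      fderiv_fun_const_smul (hu.diff_gradient t ht x)]
    simpa only [smul_apply, inner_smul_left, conj_trivial] using
      (hu.summable t ht x).mul_left c

theorem isRegular_zero : D.IsRegular 0 := by
  have hgrad : gradient (fun _ : H => (0 : ℝ)) = fun _ => 0 := by
    ext1 z
    simp [gradient]
  refine ⟨fun _ _ => differentiable_const _, fun t _ => ?_, fun t _ x => ?_, fun t _ x => ?_⟩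
  · simp only [Pi.zero_apply, hgrad]
    exact differentiable_const _
  · simp only [xGrad, Pi.zero_apply, hgrad]
    exact Submodule.zero_mem _
  · simp [hgrad]

theorem isRegular_of_mem_EA {u : ℝ × H → ℝ} (hu : u ∈ D.EA) : D.IsRegular u := by
  induction hu using Submodule.span_induction with
  | mem u hu => exact isRegular_of_mem_EAgen hu
  | zero => exact isRegular_zero
  | add u v _ _ hu hv => exact hu.add hv
  | smul c u _ hu => exact hu.const_smul c

theorem mul_mem_EA {u : ℝ × H → ℝ} (hu : u ∈ D.EA) {ρ : ℝ → ℝ} (hρ : ContDiff ℝ 1 ρ) :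
    (fun p => ρ p.1 * u p) ∈ D.EA := by
  induction hu using Submodule.span_induction with
  | mem u hu =>
    obtain ⟨f, φ, h, g, hf, hφ, hT, hg, rfl⟩ := exists_of_mem_EAgen hu
    simpa only [mul_assoc] using mem_EA_of_cos_or_sin (φ := fun t => ρ t * φ t) hf
      (hρ.contDiffOn.mul hφ) (by simp [hT]) hg
  | zero =>
    have e : (fun p : ℝ × H => ρ p.1 * (0 : ℝ × H → ℝ) p) = 0 := by ext p; simp
    rw [e]
    exact Submodule.zero_mem _
  | add u v _ _ hu hv =>
    have e : (fun p => ρ p.1 * (u + v) p) = (fun p => ρ p.1 * u p) + fun p => ρ p.1 * v p := by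
      ext p
      simp [mul_add]
    rw [e]
    exact Submodule.add_mem _ hu hv
  | smul c u _ hu =>
    have e : (fun p => ρ p.1 * (c • u) p) = c • fun p => ρ p.1 * u p := by
      ext p
      simp [mul_left_comm]
    rw [e]
    exact Submodule.smul_mem _ c hu

theorem Lzero_congr {u v : ℝ × H → ℝ} {p : ℝ × H} (h : ∀ z, u (p.1, z) = v (p.1, z))
    (hd : deriv (fun r => u (r, p.2)) p.1 = deriv (fun r => v (r, p.2)) p.1) :
    D.Lzero u p = D.Lzero v p := by
  have e : (fun z => u (p.1, z)) = fun z => v (p.1, z) := funext h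
  have hx : xGrad u p = xGrad v p := by simp only [xGrad, e]
  simp only [Lzero, Vzero, traceCD2, hd, e, hx]

theorem Lzero_eq_deriv_of_eq_zero {u : ℝ × H → ℝ} {p : ℝ × H} (h : ∀ z, u (p.1, z) = 0) :
    D.Lzero u p = deriv (fun r => u (r, p.2)) p.1 := by
  have hgrad : gradient (fun _ : H => (0 : ℝ)) = fun _ => 0 := by
    ext1 z
    simp [gradient]
  have hx : xGrad u p = 0 := by simp only [xGrad, h, hgrad]
  have hA : ∀ hk : (0 : H) ∈ D.A.adjoint.domain, D.A.adjoint ⟨0, hk⟩ = 0 := fun hk =>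
    LinearPMap.map_zero _
  simp [Lzero, Vzero, traceCD2, h, hgrad, hx, hA]

theorem Lzero_add {u v : ℝ × H → ℝ} (hu : D.IsRegular u) (hv : D.IsRegular v) {p : ℝ × H}
    (hp : p.1 ∈ Icc 0 D.T) (hdu : DifferentiableAt ℝ (fun r => u (r, p.2)) p.1)
    (hdv : DifferentiableAt ℝ (fun r => v (r, p.2)) p.1) :
    D.Lzero (u + v) p = D.Lzero u p + D.Lzero v p := by
  have hgrad := gradient_fun_add (hu.diff _ hp) (hv.diff _ hp)
  have hx : xGrad (u + v) p = xGrad u p + xGrad v p := by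
    simp only [xGrad, Pi.add_apply, hgrad]
  have hmu := hu.xGrad_mem _ hp p.2
  have hmv := hv.xGrad_mem _ hp p.2
  have htr : D.traceCD2 (u + v) p = D.traceCD2 u p + D.traceCD2 v p := by
    simp only [traceCD2]
    rw [← (hu.summable _ hp p.2).tsum_add (hv.summable _ hp p.2)]
    simp only [Pi.add_apply, hgrad,
      fderiv_fun_add (hu.diff_gradient _ hp p.2) (hv.diff_gradient _ hp p.2),
      add_apply, inner_add_left]
  have hA : D.A.adjoint ⟨xGrad u p + xGrad v p, Submodule.add_mem _ hmu hmv⟩ =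
      D.A.adjoint ⟨xGrad u p, hmu⟩ + D.A.adjoint ⟨xGrad v p, hmv⟩ :=
    LinearPMap.map_add _ ⟨xGrad u p, hmu⟩ ⟨xGrad v p, hmv⟩
  have hd : deriv (fun r => (u + v) (r, p.2)) p.1 =
      deriv (fun r => u (r, p.2)) p.1 + deriv (fun r => v (r, p.2)) p.1 := deriv_fun_add hdu hdv
  simp only [Lzero, Vzero, hd, htr, hx]
  rw [dif_pos (Submodule.add_mem _ hmu hmv), dif_pos hmu, dif_pos hmv, hA, inner_add_right,
    inner_add_right]
  ring

theorem Lzero_mul {u : ℝ × H → ℝ} (hu : D.IsRegular u) {ρ : ℝ → ℝ} {p : ℝ × H}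
    (hp : p.1 ∈ Icc 0 D.T) (hρ : DifferentiableAt ℝ ρ p.1)
    (hdu : DifferentiableAt ℝ (fun r => u (r, p.2)) p.1) :
    D.Lzero (fun q => ρ q.1 * u q) p = ρ p.1 * D.Lzero u p + deriv ρ p.1 * u p := by
  have hgrad := gradient_fun_const_mul (ρ p.1) fun z => u (p.1, z)
  have hx : xGrad (fun q => ρ q.1 * u q) p = ρ p.1 • xGrad u p := by
    simp only [xGrad, hgrad]
  have hmu := hu.xGrad_mem _ hp p.2
  have htr : D.traceCD2 (fun q => ρ q.1 * u q) p = ρ p.1 * D.traceCD2 u p := by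
    simp only [traceCD2, ← tsum_mul_left]
    simp only [hgrad, fderiv_fun_const_smul (hu.diff_gradient _ hp p.2),
      smul_apply, inner_smul_left, conj_trivial]
  have hA : D.A.adjoint ⟨ρ p.1 • xGrad u p, Submodule.smul_mem _ _ hmu⟩ =
      ρ p.1 • D.A.adjoint ⟨xGrad u p, hmu⟩ :=
    LinearPMap.map_smul _ (ρ p.1) ⟨xGrad u p, hmu⟩
  have hd : deriv (fun r => ρ r * u (r, p.2)) p.1 =
      deriv ρ p.1 * u p + ρ p.1 * deriv (fun r => u (r, p.2)) p.1 := deriv_fun_mul hρ hdu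
  simp only [Lzero, Vzero, hd, htr, hx]
  rw [dif_pos (Submodule.smul_mem _ _ hmu), dif_pos hmu, hA, inner_smul_right, inner_smul_right]
  ring

variable (D) in
/-- The elements of `E_A` that are differentiable in time on all of `[0, T]`, endpoints
included, as functions of a real variable. -/
def tameEA : Submodule ℝ (ℝ × H → ℝ) where
  carrier := {u | u ∈ D.EA ∧
    ∀ t ∈ Icc 0 D.T, ∀ x, DifferentiableAt ℝ (fun r => u (r, x)) t}
  zero_mem' := ⟨Submodule.zero_mem _, fun _ _ _ => differentiableAt_const _⟩
  add_mem' hu hv := ⟨Submodule.add_mem _ hu.1 hv.1,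
    fun t ht x => (hu.2 t ht x).add (hv.2 t ht x)⟩
  smul_mem' c _ hu := ⟨Submodule.smul_mem _ c hu.1, fun t ht x => (hu.2 t ht x).const_mul c⟩

theorem mul_mem_tameEA {u : ℝ × H → ℝ} (hu : u ∈ D.tameEA) {ρ : ℝ → ℝ} (hρ : ContDiff ℝ 1 ρ) :
    (fun p => ρ p.1 * u p) ∈ D.tameEA :=
  ⟨mul_mem_EA hu.1 hρ, fun t ht x =>
    (hρ.differentiable (by norm_num) t).mul (hu.2 t ht x)⟩

theorem mem_tameEA_of_cos_or_sin {f φ : ℝ → ℝ} {h g : ℝ → H}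
    (hf : f = Real.cos ∨ f = Real.sin) (hφ : ContDiffOn ℝ 1 φ (Icc 0 D.T)) (hT : φ D.T = 0)
    (hg : D.CinDAstar h g) (hφd : ∀ t ∈ Icc 0 D.T, DifferentiableAt ℝ φ t)
    (hhd : ∀ t ∈ Icc 0 D.T, DifferentiableAt ℝ h t) :
    (fun p : ℝ × H => φ p.1 * f ⟪p.2, h p.1⟫_ℝ) ∈ D.tameEA :=
  ⟨mem_EA_of_cos_or_sin hf hφ hT hg, fun t ht x => (hφd t ht).mul
    (((contDiff_of_cos_or_sin hf).differentiable (by norm_num) _).comp t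
      ((differentiableAt_const x).inner ℝ (hhd t ht)))⟩

theorem exists_tameEA_eq {u : ℝ × H → ℝ} (hu : u ∈ D.EA) :
    ∃ v ∈ D.tameEA, ∀ p : ℝ × H, p.1 ∈ Icc 0 D.T → v p = u p := by
  induction hu using Submodule.span_induction with
  | mem u hu =>
    obtain ⟨f, φ, h, g, hf, hφ, hT, ⟨hh, hg, hgr⟩, rfl⟩ := exists_of_mem_EAgen hu
    obtain ⟨φ', hφ', hφd⟩ :=
      exists_eqOn_Icc_differentiableAt D.hT (hφ.differentiableOn (by norm_num))
    obtain ⟨h', hh', hhd⟩ :=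
      exists_eqOn_Icc_differentiableAt D.hT (hh.differentiableOn (by norm_num))
    refine ⟨fun p => φ' p.1 * f ⟪p.2, h' p.1⟫_ℝ,
      mem_tameEA_of_cos_or_sin (g := g) hf (hφ.congr hφ') ?_ ⟨hh.congr hh', hg, fun t ht => ?_⟩
        hφd hhd, fun p hp => ?_⟩
    · rw [hφ' (right_mem_Icc.2 D.hT.le), hT]
    · rw [hh' ht]
      exact hgr t ht
    · simp only [hφ' hp, hh' hp]
  | zero => exact ⟨0, Submodule.zero_mem _, fun _ _ => rfl⟩
  | add u v _ _ hu hv =>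
    obtain ⟨u', hu', hu⟩ := hu
    obtain ⟨v', hv', hv⟩ := hv
    exact ⟨u' + v', Submodule.add_mem _ hu' hv', fun p hp => by simp [hu p hp, hv p hp]⟩
  | smul c u _ hu =>
    obtain ⟨u', hu', hu⟩ := hu
    exact ⟨c • u', Submodule.smul_mem _ c hu', fun p hp => by simp [hu p hp]⟩

end FPData

section TimeCutoff

theorem abs_sub_mul_exp_neg_le (c r : ℝ) (n : ℕ) :
    |deriv (fun t => Real.exp (-n * (t - c) ^ 2)) r| * |r - c| ≤ 2 := by
  have h : HasDerivAt (fun t : ℝ => Real.exp (-n * (t - c) ^ 2))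
      (Real.exp (-n * (r - c) ^ 2) * (-n * (2 * (r - c)))) r := by
    simpa using ((((hasDerivAt_id r).sub_const c).pow 2).const_mul (-n : ℝ)).exp
  have hn : (0 : ℝ) ≤ n * (r - c) ^ 2 := by positivity
  have h1 := Real.add_one_le_exp ((n : ℝ) * (r - c) ^ 2)
  have h2 : Real.exp (-n * (r - c) ^ 2) * Real.exp (n * (r - c) ^ 2) = 1 := by
    rw [← Real.exp_add]
    simp
  rw [h.deriv, ← abs_mul]
  have e : Real.exp (-n * (r - c) ^ 2) * (-n * (2 * (r - c))) * (r - c) =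
      -(2 * (Real.exp (-n * (r - c) ^ 2) * (n * (r - c) ^ 2))) := by ring
  rw [e, abs_neg, abs_of_nonneg (by positivity)]
  nlinarith [Real.exp_pos (-n * (r - c) ^ 2)]

theorem tendsto_exp_neg_mul_sq (c r : ℝ) :
    Tendsto (fun n : ℕ => Real.exp (-n * (r - c) ^ 2)) atTop (𝓝 (if r = c then 1 else 0)) := by
  split_ifs with h
  · simp [h]
  · have h1 : 0 < (r - c) ^ 2 := by
      have := sub_ne_zero.2 h
      positivity
    have := (tendsto_natCast_atTop_atTop (R := ℝ)).atTop_mul_const h1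
    simpa [Function.comp_def] using Real.tendsto_exp_neg_atTop_nhds_zero.comp this

theorem tendsto_deriv_exp_neg_mul_sq (c r : ℝ) :
    Tendsto (fun n : ℕ => deriv (fun t => Real.exp (-n * (t - c) ^ 2)) r) atTop (𝓝 0) := by
  have h : ∀ n : ℕ, HasDerivAt (fun t : ℝ => Real.exp (-n * (t - c) ^ 2))
      (Real.exp (-n * (r - c) ^ 2) * (-n * (2 * (r - c)))) r := fun n => by
    simpa using ((((hasDerivAt_id r).sub_const c).pow 2).const_mul (-n : ℝ)).exp
  simp only [fun n => (h n).deriv]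
  rcases eq_or_ne r c with rfl | hr
  · simp
  · have h1 : 0 < (r - c) ^ 2 := by
      have := sub_ne_zero.2 hr
      positivity
    have h2 := (Real.tendsto_pow_mul_exp_neg_atTop_nhds_zero 1).comp
      ((tendsto_natCast_atTop_atTop (R := ℝ)).atTop_mul_const h1)
    have h3 := h2.const_mul (-2 / (r - c))
    rw [mul_zero] at h3
    refine h3.congr fun n => ?_
    have := sub_ne_zero.2 hr
    simp only [Function.comp_apply, pow_one, neg_mul]
    field_simp

end TimeCutoff

namespace FPData

variable {H : Type} [NormedAddCommGroup H] [InnerProductSpace ℝ H] [CompleteSpace H]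
  [SecondCountableTopology H] [MeasurableSpace H] [BorelSpace H] {D : FPData H}
  {μ : Measure (ℝ × H)} [IsFiniteMeasure μ]

variable (D μ) in
/-- The `L¹(μ)`-closure of the image under `L₀` of the elements of `E_A` that are differentiable
in time up to the endpoints. -/
def lzeroClosure : Submodule ℝ (ℝ × H → ℝ) :=
  l1Closure μ (Submodule.span ℝ (D.Lzero '' D.tameEA))

theorem mul_Lzero_add_mem (hμ : ∀ᵐ p ∂μ, p.1 ∈ Icc 0 D.T)
    (hint : ∀ u ∈ D.EA, Integrable (D.Lzero u) μ) {u : ℝ × H → ℝ} (hu : u ∈ D.tameEA)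
    {ρ : ℝ → ℝ} (hρ : ContDiff ℝ 1 ρ) :
    (fun p => ρ p.1 * D.Lzero u p + deriv ρ p.1 * u p) ∈ D.lzeroClosure μ := by
  have hm := mul_mem_tameEA hu hρ
  refine mem_l1Closure_congr (mem_l1Closure_of_mem
    (Submodule.subset_span (mem_image_of_mem _ hm)) (hint _ hm.1)) ?_
  filter_upwards [hμ] with p hp
  exact Lzero_mul (isRegular_of_mem_EA hu.1) hp (hρ.differentiable (by norm_num) _)
    (hu.2 _ hp p.2)

theorem exists_Lzero_ae_eq (hμ : ∀ᵐ p ∂μ, p.1 ∈ Icc 0 D.T) {f : ℝ × H → ℝ}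
    (hf : f ∈ Submodule.span ℝ (D.Lzero '' D.tameEA)) :
    ∃ u ∈ D.tameEA, f =ᵐ[μ] D.Lzero u := by
  induction hf using Submodule.span_induction with
  | mem f hf =>
    obtain ⟨u, hu, rfl⟩ := hf
    exact ⟨u, hu, EventuallyEq.rfl⟩
  | zero =>
    refine ⟨0, Submodule.zero_mem _, Eventually.of_forall fun p => ?_⟩
    rw [Lzero_eq_deriv_of_eq_zero fun _ => rfl]
    simp
  | add f g _ _ hf hg =>
    obtain ⟨u, hu, hf⟩ := hf
    obtain ⟨v, hv, hg⟩ := hg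
    refine ⟨u + v, Submodule.add_mem _ hu hv, ?_⟩
    filter_upwards [hf, hg, hμ] with p h1 h2 hp
    rw [Lzero_add (isRegular_of_mem_EA hu.1) (isRegular_of_mem_EA hv.1) hp (hu.2 _ hp _)
      (hv.2 _ hp _), Pi.add_apply, h1, h2]
  | smul c f _ hf =>
    obtain ⟨u, hu, hf⟩ := hf
    refine ⟨c • u, Submodule.smul_mem _ c hu, ?_⟩
    filter_upwards [hf, hμ] with p h1 hp
    have := Lzero_mul (isRegular_of_mem_EA hu.1) (ρ := fun _ => c) hp
      (differentiableAt_const c) (hu.2 _ hp _)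
    rw [deriv_const, zero_mul, add_zero] at this
    rw [Pi.smul_apply, smul_eq_mul, h1]
    exact this.symm

theorem ite_cos_or_sin_mem (hμ : ∀ᵐ p ∂μ, p.1 ∈ Icc 0 D.T)
    (hint : ∀ u ∈ D.EA, Integrable (D.Lzero u) μ) {τ : ℝ} (hτ : τ = 0 ∨ τ = D.T)
    {f : ℝ → ℝ} (hf : f = Real.cos ∨ f = Real.sin) {h : H} (hh : h ∈ D.A.adjoint.domain) :
    (fun p : ℝ × H => if p.1 = τ then f ⟪p.2, h⟫_ℝ else 0) ∈ D.lzeroClosure μ := by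
  have hT := D.hT
  set α : ℝ → ℝ := fun t => t * (D.T - t) with hα
  have hαd : ContDiff ℝ 1 α := by fun_prop
  have hατ : α τ = 0 := by rcases hτ with rfl | rfl <;> simp [hα]
  set u : ℝ × H → ℝ := fun p => α p.1 * f ⟪p.2, h⟫_ℝ with hu
  have hum : u ∈ D.tameEA := mem_tameEA_of_cos_or_sin (h := fun _ => h)
    (g := fun _ => D.A.adjoint ⟨h, hh⟩) hf hαd.contDiffOn (by simp [hα])
    ⟨contDiffOn_const, contDiffOn_const, fun t _ => D.A.adjoint.mem_graph ⟨h, hh⟩⟩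
    (fun t _ => hαd.differentiable (by norm_num) t) fun t _ => differentiableAt_const h
  have hc : D.T - 2 * τ ≠ 0 := by rcases hτ with rfl | rfl <;> linarith
  have hLτ : ∀ p : ℝ × H, p.1 = τ → D.Lzero u p = (D.T - 2 * τ) * f ⟪p.2, h⟫_ℝ := by
    intro p hp
    rw [Lzero_eq_deriv_of_eq_zero fun z => by simp [hu, hp, hατ], hp]
    have h1 : HasDerivAt α (D.T - 2 * τ) τ := by
      refine ((hasDerivAt_id' τ).mul ((hasDerivAt_id' τ).const_sub D.T)).congr_deriv ?_
      ring
    exact (h1.mul_const (f ⟪p.2, h⟫_ℝ)).deriv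
  have hubd : ∀ p : ℝ × H, p.1 ∈ Icc 0 D.T → |u p| ≤ D.T * |p.1 - τ| := by
    rintro ⟨t, x⟩ ⟨h0, h1⟩
    have h2 : |α t| ≤ D.T * |t - τ| := by
      simp only [hα, abs_mul]
      rcases hτ with rfl | rfl
      · rw [sub_zero, mul_comm]
        gcongr
        exact abs_le.2 ⟨by simp at h1; linarith, by simp at h0; linarith⟩
      · rw [abs_sub_comm D.T t]
        gcongr
        exact abs_le.2 ⟨by simp at h0; linarith, by simpa using h1⟩
    simp only [hu, abs_mul]
    exact (mul_le_of_le_one_right (abs_nonneg _) (abs_le_one_of_cos_or_sin hf _)).trans h2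
  have hlim : (fun p : ℝ × H => if p.1 = τ then D.Lzero u p else 0) ∈ D.lzeroClosure μ := by
    refine mem_l1Closure_of_dominated (b := fun p => |D.Lzero u p| + D.T * 2)
      (F := fun n p => Real.exp (-n * (p.1 - τ) ^ 2) * D.Lzero u p +
        deriv (fun t => Real.exp (-n * (t - τ) ^ 2)) p.1 * u p)
      (fun n => mul_Lzero_add_mem hμ hint hum (ρ := fun t => Real.exp (-n * (t - τ) ^ 2))
        (by fun_prop))
      ((hint u hum.1).abs.add (integrable_const _)) (fun n => ?_) (Eventually.of_forall fun p => ?_)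
    · filter_upwards [hμ] with p hp
      refine (abs_add_le _ _).trans (add_le_add ?_ ?_)
      · rw [abs_mul, Real.abs_exp]
        refine mul_le_of_le_one_left (abs_nonneg _) (Real.exp_le_one_iff.2 ?_)
        have : (0 : ℝ) ≤ n * (p.1 - τ) ^ 2 := by positivity
        linarith
      · rw [abs_mul]
        calc _ ≤ |deriv (fun t => Real.exp (-n * (t - τ) ^ 2)) p.1| * (D.T * |p.1 - τ|) := by
              gcongr
              exact hubd p hp
          _ = D.T * (|deriv (fun t => Real.exp (-n * (t - τ) ^ 2)) p.1| * |p.1 - τ|) := by ring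
          _ ≤ D.T * 2 := by
              gcongr
              exact abs_sub_mul_exp_neg_le τ p.1 n
    · have := ((tendsto_exp_neg_mul_sq τ p.1).mul_const (D.Lzero u p)).add
        ((tendsto_deriv_exp_neg_mul_sq τ p.1).mul_const (u p))
      simpa using this
  have e : (fun p : ℝ × H => if p.1 = τ then f ⟪p.2, h⟫_ℝ else 0) =
      (D.T - 2 * τ)⁻¹ • fun p : ℝ × H => if p.1 = τ then D.Lzero u p else 0 := by
    ext p
    by_cases hp : p.1 = τ
    · simp [hp, hLτ p hp, hc]
    · simp [hp]
  rw [e]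
  exact Submodule.smul_mem _ _ hlim

theorem ite_trigSpan_mem (hμ : ∀ᵐ p ∂μ, p.1 ∈ Icc 0 D.T)
    (hint : ∀ u ∈ D.EA, Integrable (D.Lzero u) μ) {τ : ℝ} (hτ : τ = 0 ∨ τ = D.T)
    {g : H → ℝ} (hg : g ∈ trigSpan (D.A.adjoint.domain : Set H)) :
    (fun p : ℝ × H => if p.1 = τ then g p.2 else 0) ∈ D.lzeroClosure μ := by
  induction hg using Submodule.span_induction with
  | mem g hg =>
    obtain ⟨h, hh, rfl | rfl⟩ := hg
    · exact ite_cos_or_sin_mem hμ hint hτ (Or.inl rfl) hh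
    · exact ite_cos_or_sin_mem hμ hint hτ (Or.inr rfl) hh
  | zero =>
    have e : (fun p : ℝ × H => if p.1 = τ then (0 : H → ℝ) p.2 else 0) = 0 := by
      ext p
      simp
    rw [e]
    exact Submodule.zero_mem _
  | add f g _ _ hf hg =>
    have e : (fun p : ℝ × H => if p.1 = τ then (f + g) p.2 else 0) =
        (fun p : ℝ × H => if p.1 = τ then f p.2 else 0) +
          fun p : ℝ × H => if p.1 = τ then g p.2 else 0 := by
      ext p
      by_cases hp : p.1 = τ <;> simp [hp]
    rw [e]
    exact Submodule.add_mem _ hf hg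
  | smul c g _ hg =>
    have e : (fun p : ℝ × H => if p.1 = τ then (c • g) p.2 else 0) =
        c • fun p : ℝ × H => if p.1 = τ then g p.2 else 0 := by
      ext p
      simp
    rw [e]
    exact Submodule.smul_mem _ c hg

theorem indicator_mem_lzeroClosure (hμ : ∀ᵐ p ∂μ, p.1 ∈ Icc 0 D.T)
    (hint : ∀ u ∈ D.EA, Integrable (D.Lzero u) μ) {τ : ℝ} (hτ : τ = 0 ∨ τ = D.T)
    {f : ℝ × H → ℝ} (hf : Integrable f μ) :
    {p : ℝ × H | p.1 = τ}.indicator f ∈ D.lzeroClosure μ := by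
  set s : Set (ℝ × H) := {p | p.1 = τ} with hs
  have hsm : MeasurableSet s := measurable_fst (measurableSet_singleton τ)
  have hfs : Integrable f (μ.restrict s) := hf.restrict
  obtain ⟨f', hf'm, hff'⟩ := hf.1
  have hslice : (fun p => f' (τ, p.2)) =ᵐ[μ.restrict s] f := by
    filter_upwards [ae_restrict_mem hsm, ae_restrict_of_ae hff'] with p hp hp'
    rw [hp']
    congr 1
    exact Prod.ext (Eq.symm hp) rfl
  have hk : StronglyMeasurable fun x => f' (τ, x) :=
    hf'm.comp_measurable (measurable_const.prodMk measurable_id)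
  have hki : Integrable (fun x => f' (τ, x)) ((μ.restrict s).map Prod.snd) :=
    (integrable_map_measure hk.aestronglyMeasurable measurable_snd.aemeasurable).2
      (hfs.congr hslice.symm)
  refine mem_l1Closure_of_approx (hf.indicator hsm) fun ε hε => ?_
  obtain ⟨g, hg, hgε⟩ := exists_trigSpan_integral_sub_lt D.dense_adjoint_domain hki hε
  refine ⟨_, ite_trigSpan_mem hμ hint hτ hg, ?_⟩
  have hgm : AEStronglyMeasurable g ((μ.restrict s).map Prod.snd) :=
    (memLp_of_mem_trigSpan hg 1).1
  have e : (fun p : ℝ × H => |s.indicator f p - if p.1 = τ then g p.2 else 0|) =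
      s.indicator fun p => |f p - g p.2| := by
    ext p
    by_cases hp : p ∈ s
    · simp [hp, show p.1 = τ from hp]
    · simp [hp, show p.1 ≠ τ from hp]
  rw [e, integral_indicator hsm]
  refine lt_of_eq_of_lt ?_ hgε
  have hdm : AEStronglyMeasurable (fun x => |f' (τ, x) - g x|) ((μ.restrict s).map Prod.snd) :=
    (hki.1.sub hgm).norm
  rw [integral_map measurable_snd.aemeasurable hdm]
  refine integral_congr_ae ?_
  filter_upwards [hslice] with p hp
  rw [hp]

theorem integrable_exp_mul (hμ : ∀ᵐ p ∂μ, p.1 ∈ Icc 0 D.T) (c : ℝ) {f : ℝ × H → ℝ}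
    (hf : Integrable f μ) : Integrable (fun p => Real.exp (c * p.1) * f p) μ := by
  refine hf.bdd_mul (c := Real.exp (|c| * D.T)) (by fun_prop) ?_
  filter_upwards [hμ] with p hp
  rw [Real.norm_eq_abs, Real.abs_exp, Real.exp_le_exp]
  exact mul_le_mul (le_abs_self c) hp.2 hp.1 (abs_nonneg c)

theorem exp_mul_Lzero_sub_mem (hμ : ∀ᵐ p ∂μ, p.1 ∈ Icc 0 D.T)
    (hint : ∀ u ∈ D.EA, Integrable (D.Lzero u) μ) (lam : ℝ) {u : ℝ × H → ℝ} (hu : u ∈ D.EA) :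
    (fun p => Real.exp (-lam * p.1) * (D.Lzero u p - lam * u p)) ∈ D.lzeroClosure μ := by
  obtain ⟨v, hv, huv⟩ := exists_tameEA_eq hu
  have hmul := mul_Lzero_add_mem hμ hint hv (ρ := fun t => Real.exp (-lam * t)) (by fun_prop)
  have hd := integrable_exp_mul hμ (-lam) ((hint u hu).sub (hint v hv.1))
  have h0 := indicator_mem_lzeroClosure hμ hint (Or.inl rfl) hd
  have hT := indicator_mem_lzeroClosure hμ hint (Or.inr rfl) hd
  refine mem_l1Closure_congr (Submodule.add_mem _ hmul (Submodule.add_mem _ h0 hT)) ?_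
  filter_upwards [hμ] with p hp
  have hder : deriv (fun t => Real.exp (-lam * t)) p.1 = Real.exp (-lam * p.1) * -lam := by
    simpa using (((hasDerivAt_id p.1).const_mul (-lam)).exp).deriv
  have hT0 := D.hT
  simp only [Pi.add_apply, Pi.sub_apply, indicator_apply, mem_ofPred_eq, hder, huv p hp]
  rcases eq_or_lt_of_le hp.1 with h | h
  · rw [if_pos h.symm, if_neg (by rw [← h]; exact hT0.ne)]
    ring
  rcases eq_or_lt_of_le hp.2 with h' | h'
  · rw [if_neg h.ne', if_pos h']
    ring
  have hL : D.Lzero u p = D.Lzero v p := by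
    refine Lzero_congr (fun z => (huv (p.1, z) hp).symm) (EventuallyEq.deriv_eq ?_)
    filter_upwards [Icc_mem_nhds h h'] with r hr
    exact (huv (r, p.2) hr).symm
  rw [if_neg h.ne', if_neg h'.ne, hL]
  ring

/-- Up to the factor `-e^{-λt}`, the functions `λu - L₀u` belong to the closure of the image
of `L₀`; so if they are dense, every integrable function does. -/
theorem mem_lzeroClosure (hμ : ∀ᵐ p ∂μ, p.1 ∈ Icc 0 D.T)
    (hint : ∀ u ∈ D.EA, Integrable (D.Lzero u) μ) {lam : ℝ}
    (hdense : ∀ f : ℝ × H → ℝ, Integrable f μ → ∀ ε > 0,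
      ∃ u ∈ D.EA, Integrable (fun p => lam * u p - D.Lzero u p) μ ∧
        ∫ p, |f p - (lam * u p - D.Lzero u p)| ∂μ < ε)
    {f : ℝ × H → ℝ} (hf : Integrable f μ) : f ∈ D.lzeroClosure μ := by
  refine mem_l1Closure_of_approx hf fun ε hε => ?_
  set K := Real.exp (|lam| * D.T) with hK
  have hK0 : 0 < K := Real.exp_pos _
  have hef := integrable_exp_mul hμ lam hf
  obtain ⟨u, hu, hui, hlt⟩ := hdense _ hef (ε / K) (by positivity)
  refine ⟨_, Submodule.neg_mem _ (exp_mul_Lzero_sub_mem hμ hint lam hu), ?_⟩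
  have hle : ∫ p, |f p - (-fun p => Real.exp (-lam * p.1) * (D.Lzero u p - lam * u p)) p| ∂μ ≤
      ∫ p, K * |Real.exp (lam * p.1) * f p - (lam * u p - D.Lzero u p)| ∂μ := by
    refine integral_mono_of_nonneg (Eventually.of_forall fun p => abs_nonneg _)
      ((hef.sub hui).abs.const_mul K) ?_
    filter_upwards [hμ] with p hp
    have h1 : Real.exp (-lam * p.1) * Real.exp (lam * p.1) = 1 := by
      rw [← Real.exp_add]
      simp
    have h2 : Real.exp (-lam * p.1) ≤ K := by
      rw [hK, Real.exp_le_exp]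
      exact mul_le_mul (neg_le_abs lam) hp.2 hp.1 (abs_nonneg _)
    have e : f p - (-fun p => Real.exp (-lam * p.1) * (D.Lzero u p - lam * u p)) p =
        Real.exp (-lam * p.1) * (Real.exp (lam * p.1) * f p - (lam * u p - D.Lzero u p)) := by
      rw [Pi.neg_apply]
      linear_combination -f p * h1
    simp only [e, abs_mul, Real.abs_exp]
    gcongr
  refine hle.trans_lt ?_
  rw [integral_const_mul, mul_comm]
  exact (lt_div_iff₀ hK0).1 hlt

end FPData
section Theorems

open MeasureTheory Set Filter Topology
open scoped InnerProductSpace ENNReal NNReal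

variable {H : Type} [NormedAddCommGroup H] [InnerProductSpace ℝ H] [CompleteSpace H]
  [SecondCountableTopology H] [MeasurableSpace H] [BorelSpace H]

/-- Remark 2.1: if `(λ - L₀)(D(L₀))` is dense in `L¹([s,T] × H, μ)` for some
`λ ∈ ℝ`, then `L₀(D(L₀))` is dense in `L¹([s,T] × H, μ)`. -/
theorem statement3 (D : FPData H) (s : ℝ) (hs : s ∈ Icc 0 D.T)
    (μ : Measure (ℝ × H)) [IsFiniteMeasure μ]
    (hconc : μ {p : ℝ × H | p.1 ∉ Icc s D.T} = 0)
    (hint : ∀ u ∈ D.EA, Integrable (D.Lzero u) μ)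
    (lam : ℝ)
    (hdense : ∀ f : ℝ × H → ℝ, Integrable f μ → ∀ ε > 0,
      ∃ u ∈ D.EA, Integrable (fun p => lam * u p - D.Lzero u p) μ ∧
        ∫ p, |f p - (lam * u p - D.Lzero u p)| ∂μ < ε) :
    DenseRangeL1 μ (D.Lzero '' D.EA) := by
  have hμ : ∀ᵐ p ∂μ, p.1 ∈ Icc 0 D.T := by
    filter_upwards [mem_ae_iff.2 hconc] with p hp
    exact Icc_subset_Icc_left hs.1 hp
  intro f hf ε hε
  obtain ⟨g, hg, hgi, hlt⟩ := (FPData.mem_lzeroClosure hμ hint hdense hf).2 ε hε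
  obtain ⟨u, hu, hgu⟩ := FPData.exists_Lzero_ae_eq hμ hg
  refine ⟨_, mem_image_of_mem _ hu.1, hint u hu.1, lt_of_eq_of_lt (integral_congr_ae ?_) hlt⟩
  filter_upwards [hgu] with p hp
  rw [hp]

end Theorems
end

section
/- For every s ∈ [0,T], every Borel probability measure ζ on H, and every λ ≥ 0, one has the inclusion M_{s,ζ} ⊂ M_s^λ; that is, every solution of the Fokker–Planck equation with initial condition ζ satisfies the sub-invariance inequality ∫_s^T ∫_H L₀u dν_t dt ≤ 2λ ∫_s^T ∫_H u dν_t dt for all nonnegative u ∈ E_A([0,T]×H). -/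
open MeasureTheory Set Filter Topology
open scoped InnerProductSpace ENNReal NNReal

attribute [local instance] Classical.propDecidable

/-- A test function in `E_A` is dominated by a continuous function of time vanishing at `T`. -/
theorem FPData.exists_bound_of_mem_EA {H : Type} [NormedAddCommGroup H]
    [InnerProductSpace ℝ H] [CompleteSpace H] [MeasurableSpace H] (D : FPData H)
    {u : ℝ × H → ℝ} (hu : u ∈ D.EA) :
    ∃ ψ : ℝ → ℝ, ContinuousOn ψ (Icc 0 D.T) ∧ ψ D.T = 0 ∧ ∀ p, |u p| ≤ ψ p.1 := by
  refine Submodule.span_induction (p := fun u _ => ∃ ψ : ℝ → ℝ,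
    ContinuousOn ψ (Icc 0 D.T) ∧ ψ D.T = 0 ∧ ∀ p, |u p| ≤ ψ p.1) ?_ ?_ ?_ ?_ hu
  · rintro u ⟨φ, h, g, hφ, hφT, -, hu⟩
    refine ⟨fun t => |φ t|, hφ.continuousOn.abs, by simp [hφT], fun p => ?_⟩
    rcases hu with rfl | rfl
    · simpa only [abs_mul] using
        mul_le_of_le_one_right (abs_nonneg _) (Real.abs_cos_le_one _)
    · simpa only [abs_mul] using
        mul_le_of_le_one_right (abs_nonneg _) (Real.abs_sin_le_one _)
  · exact ⟨fun _ => 0, continuousOn_const, rfl, by simp⟩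
  · rintro u v - - ⟨ψ, hψ, hψT, hle⟩ ⟨χ, hχ, hχT, hle'⟩
    exact ⟨fun t => ψ t + χ t, hψ.add hχ, by simp [hψT, hχT],
      fun p => (abs_add_le _ _).trans (add_le_add (hle p) (hle' p))⟩
  · rintro a u - ⟨ψ, hψ, hψT, hle⟩
    refine ⟨fun t => |a| * ψ t, continuousOn_const.mul hψ, by simp [hψT], fun p => ?_⟩
    simpa only [Pi.smul_apply, smul_eq_mul, abs_mul] using
      mul_le_mul_of_nonneg_left (hle p) (abs_nonneg a)

/-- An inequality between continuous functions on a nondegenerate compact interval that holds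
almost everywhere holds everywhere. -/
theorem ContinuousOn.le_on_Icc_of_ae_le {a b : ℝ} (hab : a ≠ b) {f g : ℝ → ℝ}
    (hf : ContinuousOn f (Icc a b)) (hg : ContinuousOn g (Icc a b))
    (hfg : ∀ᵐ t ∂(volume.restrict (Icc a b)), f t ≤ g t) {t : ℝ} (ht : t ∈ Icc a b) :
    f t ≤ g t := by
  have hEq : EqOn (fun t => max (f t) (g t)) g (Icc a b) :=
    Measure.eqOn_Icc_of_ae_eq volume hab (hfg.mono fun t ht => max_eq_right ht)
      (hf.sup hg) hg
  exact max_eq_right_iff.mp (hEq ht)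

/-- The total mass of `L₀u` along a solution of the Fokker–Planck equation is nonpositive when
the initial value of `u` is nonnegative. -/
theorem FPData.IsFPSol.integral_Lzero_nonpos {H : Type} [NormedAddCommGroup H]
    [InnerProductSpace ℝ H] [CompleteSpace H] [MeasurableSpace H] {D : FPData H} {s : ℝ}
    (hs : s ∈ Icc 0 D.T)
    {ζ : Measure H} {μ : Measure (ℝ × H)} {μt : ℝ → Measure H} (h : D.IsFPSol s ζ μ μt)
    {u : ℝ × H → ℝ} (hu : u ∈ D.EA) (hus : ∀ y, 0 ≤ u (s, y)) :
    ∫ t in Icc s D.T, (∫ y, D.Lzero u (t, y) ∂(μt t)) ≤ 0 := by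
  obtain ⟨hprob, -, -, hFP⟩ := h
  by_cases hint : IntegrableOn (fun t => ∫ y, D.Lzero u (t, y) ∂(μt t)) (Icc s D.T)
  swap
  · exact (integral_undef hint).le
  rcases eq_or_ne s D.T with hsT | hsT
  · simp [hsT]
  obtain ⟨ψ, hψ, hψT, hle⟩ := D.exists_bound_of_mem_EA hu
  have hmain := ContinuousOn.le_on_Icc_of_ae_le hsT
    (f := fun t => ∫ y, u (s, y) ∂ζ + ∫ r in Icc s t, ∫ y, D.Lzero u (r, y) ∂(μt r))
    (continuousOn_const.add (intervalIntegral.continuousOn_primitive_Icc hint))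
    (hψ.mono (Icc_subset_Icc_left hs.1)) ?_ (right_mem_Icc.2 hs.2)
  · have hζ : 0 ≤ ∫ y, u (s, y) ∂ζ := integral_nonneg hus
    simp only [hψT] at hmain
    linarith
  · filter_upwards [hFP u hu, ae_restrict_mem measurableSet_Icc] with t ht htmem
    have := hprob t htmem
    rw [← ht]
    refine (le_abs_self _).trans ?_
    simpa using norm_integral_le_of_norm_le_const (μ := μt t) (f := fun y => u (t, y))
      (C := ψ t) (Eventually.of_forall fun y => hle (t, y))

section Theorems

open MeasureTheory Set Filter Topology
open scoped InnerProductSpace ENNReal NNReal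

variable {H : Type} [NormedAddCommGroup H] [InnerProductSpace ℝ H] [CompleteSpace H]
  [SecondCountableTopology H] [MeasurableSpace H] [BorelSpace H]

/-- Remark 4.2: `M_{s,ζ} ⊆ M_s^λ` for every `λ ≥ 0`. -/
theorem statement4 (D : FPData H) (s : ℝ) (hs : s ∈ Icc 0 D.T)
    (ζ : Measure H) [IsProbabilityMeasure ζ] (lam : ℝ) (hlam : 0 ≤ lam)
    (μ : Measure (ℝ × H)) (μt : ℝ → Measure H) (h : D.IsFPSol s ζ μ μt) :
    D.IsSubInv lam s μ μt := by
  refine ⟨fun t ht => have := h.1 t ht; inferInstance, h.2.1, h.2.2.1, fun u hu hpos => ?_⟩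
  refine (h.integral_Lzero_nonpos hs hu fun y => hpos (s, y) hs).trans ?_
  have hu_nonneg : 0 ≤ ∫ t in Icc s D.T, ∫ y, u (t, y) ∂(μt t) :=
    setIntegral_nonneg measurableSet_Icc fun t ht =>
      integral_nonneg fun y => hpos (t, y) ⟨hs.1.trans ht.1, ht.2⟩
  positivity

end Theorems
end
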